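/- arXiv:0910.1476 — 2 statements merged into one kernel-verified Lean document; each statement's English description precedes it below -/
import Mathlib

section
/- Let 1 ≤ i ≤ n−p with 2i+2 > n−p. Then there exists a nonempty Zariski open subset O of ℂ^{(n−p)×n} such that for every a ∈ O the generic polar varieties W_{K(\underline{a^{(i)}})}(S) and W_{\bar K(\bar{a^{(i)}})}(S) are smooth at every point of them where J(F_1, …, F_p) has maximal rank p. -/
open MvPolynomial

noncomputable section

/-- The Zariski closure of a subset of the affine space `σ → ℂ`. -/
def zcl {σ : Type} (T : Set (σ → ℂ)) : Set (σ → ℂ) :=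
  MvPolynomial.zeroLocus ℂ (MvPolynomial.vanishingIdeal ℂ T)

/-- Zariski open subsets of the affine space `σ → ℂ`. -/
def ZOpen {σ : Type} (U : Set (σ → ℂ)) : Prop :=
  ∃ I : Ideal (MvPolynomial σ ℂ), U = {x | ∃ f ∈ I, MvPolynomial.eval x f ≠ 0}

/-- Zariski open subsets of the space of `m × n` complex matrices. -/
def ZOpenMat {m n : ℕ} (U : Set (Matrix (Fin m) (Fin n) ℂ)) : Prop :=
  ∃ I : Ideal (MvPolynomial (Fin m × Fin n) ℂ),
    U = {a | ∃ f ∈ I, MvPolynomial.eval (fun q => a q.1 q.2) f ≠ 0}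

/-- `T` is of pure dimension `d`: every irreducible component of (the Zariski closure of) `T`,
i.e. every minimal prime over its vanishing ideal, has coordinate ring of Krull dimension `d`. -/
def IsPureDim {σ : Type} (T : Set (σ → ℂ)) (d : ℕ) : Prop :=
  ∀ P ∈ (MvPolynomial.vanishingIdeal ℂ T).minimalPrimes,
    ringKrullDim (MvPolynomial σ ℂ ⧸ P) = (d : WithBot (WithTop ℕ))

/-- The Zariski tangent space at a point `x` of (the Zariski closure of) a subset `T`
of affine space: the common kernel of the differentials at `x` of all polynomials
vanishing on `T`. -/
def tangentAt {σ : Type} [Fintype σ] [DecidableEq σ] (T : Set (σ → ℂ)) (x : σ → ℂ) :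
    Submodule ℂ (σ → ℂ) :=
  ⨅ (f : MvPolynomial σ ℂ) (_ : f ∈ MvPolynomial.vanishingIdeal ℂ T),
    LinearMap.ker
      (∑ l, MvPolynomial.eval x (MvPolynomial.pderiv l f) •
        (LinearMap.proj l : (σ → ℂ) →ₗ[ℂ] ℂ))

/-- `rs` is a regular sequence in the commutative ring `R`. -/
def IsRegSeq {R : Type*} [CommRing R] (rs : List R) : Prop :=
  Ideal.span {x | x ∈ rs} ≠ ⊤ ∧
  ∀ j, j < rs.length → ∀ b : R,
    rs.getD j 0 * b ∈ Ideal.span {x | x ∈ rs.take j} →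
    b ∈ Ideal.span {x | x ∈ rs.take j}

/-- The common zero set in `ℂⁿ` of polynomials `F₁, …, F_p ∈ ℚ[X₁, …, Xₙ]`. -/
def zeroSetC {n p : ℕ} (F : Fin p → MvPolynomial (Fin n) ℚ) : Set (Fin n → ℂ) :=
  {x | ∀ k, MvPolynomial.aeval x (F k) = 0}

/-- The Jacobian matrix `[∂F_k/∂X_l]` evaluated at `x ∈ ℂⁿ`. -/
def jacC {n p : ℕ} (F : Fin p → MvPolynomial (Fin n) ℚ) (x : Fin n → ℂ) :
    Matrix (Fin p) (Fin n) ℂ :=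
  Matrix.of fun k l => MvPolynomial.aeval x (MvPolynomial.pderiv l (F k))

/-- The set of regular points of `S = {F₁ = 0, …, F_p = 0}`: points of `S` where the
Jacobian has maximal rank `p`. -/
def SregC {n p : ℕ} (F : Fin p → MvPolynomial (Fin n) ℚ) : Set (Fin n → ℂ) :=
  {x | x ∈ zeroSetC F ∧ (jacC F x).rank = p}

/-- The classic polar variety: the Zariski closure of the locus of regular points of `S`
where the matrix obtained by appending the rows of `a` to the Jacobian has rank at
most `r` (i.e. where all `(r+1)`-minors vanish). -/
def Wclassic {n p m : ℕ} (F : Fin p → MvPolynomial (Fin n) ℚ)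
    (a : Matrix (Fin m) (Fin n) ℂ) (r : ℕ) : Set (Fin n → ℂ) :=
  zcl {x | x ∈ SregC F ∧ (Matrix.fromRows (jacC F x) a).rank ≤ r}

/-- The dual polar variety: as `Wclassic`, with appended rows `(a_{k,1} - X₁, …, a_{k,n} - Xₙ)`. -/
def Wdual {n p m : ℕ} (F : Fin p → MvPolynomial (Fin n) ℚ)
    (a : Matrix (Fin m) (Fin n) ℂ) (r : ℕ) : Set (Fin n → ℂ) :=
  zcl {x | x ∈ SregC F ∧
    (Matrix.fromRows (jacC F x) (Matrix.of fun k l => a k l - x l)).rank ≤ r}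

/-- `F₁, …, F_p` generate the full vanishing ideal of their zero set (over `ℂ`);
this encodes that `(F₁, …, F_p)` is reduced (radical) and the ideal of definition of `S`. -/
def idealOfDef {n p : ℕ} (F : Fin p → MvPolynomial (Fin n) ℚ) : Prop :=
  MvPolynomial.vanishingIdeal ℂ (zeroSetC F) =
    Ideal.span (Set.range fun k => MvPolynomial.map (algebraMap ℚ ℂ) (F k))

/-- The submatrix of the first `m` rows of a matrix. -/
def firstRows {N n' m : ℕ} (a : Matrix (Fin N) (Fin n') ℂ) (h : m ≤ N) :
    Matrix (Fin m) (Fin n') ℂ :=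
  Matrix.of fun k l => a (Fin.castLE h k) l

/-- The matrix obtained by deleting row `h`. -/
def rowErase {m n' : ℕ} (a : Matrix (Fin (m + 1)) (Fin n') ℂ) (h : Fin (m + 1)) :
    Matrix (Fin m) (Fin n') ℂ :=
  Matrix.of fun k l => a (h.succAbove k) l

/-- The real trace `S_ℝ := S ∩ ℝⁿ`, as a subset of Euclidean space. -/
def SR {n p : ℕ} (F : Fin p → MvPolynomial (Fin n) ℚ) : Set (EuclideanSpace ℝ (Fin n)) :=
  {x | (fun j => (x j : ℂ)) ∈ zeroSetC F}

/-- `C` is a connected component of `T`. -/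
def IsConnCompOf {α : Type*} [TopologicalSpace α] (C T : Set α) : Prop :=
  C.Nonempty ∧ C ⊆ T ∧ IsPreconnected C ∧
    ∀ D, C ⊆ D → D ⊆ T → IsPreconnected D → D = C

end

open scoped TensorProduct

theorem exists_derivation_extending {Λ K : Type} [CommRing Λ] [IsDomain Λ] [Algebra ℂ Λ]
    [Field K] [Algebra ℂ K] [Algebra Λ K] [IsScalarTower ℂ Λ K]
    (hinj : Function.Injective (algebraMap Λ K)) [Algebra.EssFiniteType ℂ K]
    (d : Derivation ℂ Λ K) :
    ∃ D : Derivation ℂ K K, ∀ x, D (algebraMap Λ K x) = d x := by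
  have : FaithfulSMul Λ K := (faithfulSMul_iff_algebraMap_injective Λ K).2 hinj
  let _ : Algebra (FractionRing Λ) K := FractionRing.liftAlgebra Λ K
  have : IsScalarTower Λ (FractionRing Λ) K := FractionRing.isScalarTower_liftAlgebra Λ K
  have : IsScalarTower ℂ (FractionRing Λ) K := IsScalarTower.of_algebraMap_eq fun x => by
    rw [IsScalarTower.algebraMap_apply ℂ Λ (FractionRing Λ), ← IsScalarTower.algebraMap_apply Λ,
      ← IsScalarTower.algebraMap_apply ℂ Λ]
  have : Algebra.EssFiniteType (FractionRing Λ) K :=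
    Algebra.EssFiniteType.of_comp ℂ (FractionRing Λ) K
  have : CharZero (FractionRing Λ) := charZero_of_injective_algebraMap
    (algebraMap ℂ (FractionRing Λ)).injective
  have : Algebra.FormallyEtale Λ (FractionRing Λ) :=
    Algebra.FormallyEtale.of_isLocalization (nonZeroDivisors Λ)
  have : Algebra.FormallySmooth Λ K := Algebra.FormallySmooth.comp Λ (FractionRing Λ) K
  have hι : Function.Injective (KaehlerDifferential.mapBaseChange ℂ Λ K) := by
    rw [injective_iff_map_eq_zero]
    intro x hx
    obtain ⟨x, rfl⟩ := (Algebra.H1Cotangent.exact_δ_mapBaseChange ℂ Λ K x).mp hx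
    rw [Subsingleton.elim x 0, map_zero]
  obtain ⟨g, hg⟩ := LinearMap.exists_leftInverse_of_injective
    (KaehlerDifferential.mapBaseChange ℂ Λ K) (LinearMap.ker_eq_bot.2 hι)
  refine ⟨((d.liftKaehlerDifferential.liftBaseChange K).comp g).compDer
    (KaehlerDifferential.D ℂ K), fun x => ?_⟩
  have h1 : KaehlerDifferential.D ℂ K (algebraMap Λ K x) =
      KaehlerDifferential.mapBaseChange ℂ Λ K (1 ⊗ₜ KaehlerDifferential.D ℂ Λ x) := by simp
  have h2 := LinearMap.congr_fun hg (1 ⊗ₜ KaehlerDifferential.D ℂ Λ x)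
  simp only [LinearMap.comp_apply, LinearMap.id_apply] at h2
  change d.liftKaehlerDifferential.liftBaseChange K (g (KaehlerDifferential.D ℂ K _)) = _
  rw [h1, h2]
  simp

theorem exists_derivation_apply_X {σ K : Type} [Field K] [Algebra ℂ K]
    [Algebra.EssFiniteType ℂ K] (ψ : MvPolynomial σ ℂ →ₐ[ℂ] K) (hψ : Function.Injective ψ)
    (ν : σ → K) : ∃ D : Derivation ℂ K K, ∀ s, D (ψ (X s)) = ν s := by
  let _ : Algebra (MvPolynomial σ ℂ) K := ψ.toAlgebra
  have : IsScalarTower ℂ (MvPolynomial σ ℂ) K := IsScalarTower.of_algebraMap_eq fun x =>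
    (ψ.commutes x).symm
  obtain ⟨D, hD⟩ := exists_derivation_extending (Λ := MvPolynomial σ ℂ) hψ (mkDerivation ℂ ν)
  exact ⟨D, fun s => (hD (X s)).trans (mkDerivation_X ℂ ν s)⟩

theorem exists_ne_zero_eval_eq_zero_or_generic_point {Y σ : Type} [Finite Y] [Finite σ]
    (G : Set (MvPolynomial (Y ⊕ σ) ℂ)) :
    (∃ d : MvPolynomial σ ℂ, d ≠ 0 ∧ ∀ z : Y ⊕ σ → ℂ,
      (∀ g ∈ G, aeval z g = 0) → eval (fun s => z (Sum.inr s)) d = 0) ∨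
    ∃ (K : Type) (_ : Field K) (_ : Algebra ℂ K) (z : Y ⊕ σ → K),
      (∀ g ∈ G, aeval z g = 0) ∧
        ∀ ν : σ → K, ∃ D : Derivation ℂ K K, ∀ s, D (z (Sum.inr s)) = ν s := by
  classical
  let ρ : MvPolynomial σ ℂ →ₐ[ℂ] MvPolynomial (Y ⊕ σ) ℂ := rename Sum.inr
  let M : Submonoid (MvPolynomial (Y ⊕ σ) ℂ) := (nonZeroDivisors (MvPolynomial σ ℂ)).map ρ
  by_cases hdis : Disjoint (Ideal.span G : Set (MvPolynomial (Y ⊕ σ) ℂ)) M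
  · right
    obtain ⟨P, hP, hle, hPM⟩ := Ideal.exists_le_prime_disjoint _ M hdis
    let K := FractionRing (MvPolynomial (Y ⊕ σ) ℂ ⧸ P)
    let φ : MvPolynomial (Y ⊕ σ) ℂ →ₐ[ℂ] K :=
      (IsScalarTower.toAlgHom ℂ (MvPolynomial (Y ⊕ σ) ℂ ⧸ P) K).comp (Ideal.Quotient.mkₐ ℂ P)
    have hφ : ∀ g, φ g = 0 ↔ g ∈ P := fun g => by
      have := FaithfulSMul.algebraMap_injective (MvPolynomial (Y ⊕ σ) ℂ ⧸ P) K
      simp [φ, Ideal.Quotient.eq_zero_iff_mem]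
    let z : Y ⊕ σ → K := fun t => φ (X t)
    have hz : ∀ g, aeval z g = φ g := fun g => by
      have : aeval z = φ := by ext t; simp [z]
      rw [this]
    refine ⟨K, inferInstance, inferInstance, z, fun g hg => ?_, fun ν => ?_⟩
    · rw [hz, hφ]
      exact hle (Ideal.subset_span hg)
    · have hess : Algebra.EssFiniteType (MvPolynomial (Y ⊕ σ) ℂ ⧸ P) K :=
        Algebra.EssFiniteType.of_isLocalization _ (nonZeroDivisors _)
      have : Algebra.EssFiniteType ℂ K :=
        Algebra.EssFiniteType.comp ℂ (MvPolynomial (Y ⊕ σ) ℂ ⧸ P) K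
      obtain ⟨D, hD⟩ := exists_derivation_apply_X (φ.comp ρ) (by
        rw [injective_iff_map_eq_zero]
        intro x hx
        by_contra hne
        exact Set.disjoint_left.1 hPM ((hφ _).1 hx)
          ⟨x, mem_nonZeroDivisors_of_ne_zero hne, rfl⟩) ν
      exact ⟨D, fun s => by simpa [ρ] using hD s⟩
  · left
    obtain ⟨_, hx, d, hd, rfl⟩ := Set.not_disjoint_iff.1 hdis
    refine ⟨d, nonZeroDivisors.ne_zero hd, fun z hz => ?_⟩
    have hle : Ideal.span G ≤ RingHom.ker (aeval z : MvPolynomial (Y ⊕ σ) ℂ →ₐ[ℂ] ℂ) :=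
      Ideal.span_le.2 hz
    have := hle hx
    rw [RingHom.mem_ker] at this
    simpa [ρ, aeval_rename, Function.comp_def, aeval_eq_eval] using this

/-- The matrix whose row `r` is `P r`, with the row `a s` added to each row in the second block. -/
noncomputable def pencil {n p m : ℕ} {A : Type} [CommRing A] [Algebra ℂ A]
    (P : Fin p ⊕ Fin m → Fin n → MvPolynomial (Fin n) ℂ) (x : Fin n → A)
    (a : Fin m × Fin n → A) : Matrix (Fin p ⊕ Fin m) (Fin n) A :=
  Matrix.of fun r l => aeval x (P r l) + Sum.elim (fun _ => 0) (fun s => a (s, l)) r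

/-- The data of a failure of transversality along a `k`-dimensional space of left null vectors of a
pencil: a point `x` of `{f = 0}`, left null vectors `c`, a dual system `ν` certifying that the
second blocks of `c` are independent, right null vectors `w`, not all zero as certified by `u`,
and coefficients `v`. -/
structure IsTangencyWitness {n p m k : ℕ} {A : Type} [CommRing A] [Algebra ℂ A]
    (f : Fin p → MvPolynomial (Fin n) ℂ) (P : Fin p ⊕ Fin m → Fin n → MvPolynomial (Fin n) ℂ)
    (a : Fin m × Fin n → A) (x : Fin n → A) (c : Fin k → Fin p ⊕ Fin m → A)
    (ν : Fin k → Fin m → A) (v : Fin p → A) (w u : Fin k → Fin n → A) : Prop where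
  point : ∀ j, aeval x (f j) = 0
  left_null : ∀ d l, ∑ r, c d r * pencil P x a r l = 0
  dual : ∀ d e, ∑ s, c d (Sum.inr s) * ν e s = if d = e then 1 else 0
  right_null : ∀ d r, ∑ l, pencil P x a r l * w d l = 0
  conormal : ∀ j, ∑ i, v i * aeval x (pderiv j (f i)) +
    ∑ d, ∑ r, ∑ l, c d r * aeval x (pderiv j (P r l)) * w d l = 0
  nonzero : ∑ d, ∑ l, u d l * w d l = 1

theorem Derivation.map_aeval_eq_sum_pderiv {σ K : Type} [Fintype σ] [CommRing K] [Algebra ℂ K]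
    (D : Derivation ℂ K K) (x : σ → K) (g : MvPolynomial σ ℂ) :
    D (aeval x g) = ∑ j, aeval x (pderiv j g) * D (x j) := by
  classical
  induction g using MvPolynomial.induction_on with
  | C c => simp
  | add g h hg hh => simp [hg, hh, add_mul, Finset.sum_add_distrib]
  | mul_X g i hg =>
    simp only [map_mul, aeval_X, Derivation.leibniz, hg, smul_eq_mul, pderiv_X, map_add,
      add_mul, Finset.sum_add_distrib, Pi.single_apply, apply_ite (aeval x), map_zero,
      mul_ite, ite_mul, mul_one, mul_zero, zero_mul, Finset.mul_sum, Finset.sum_ite_eq,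
      Finset.mem_univ, if_true]
    simp [mul_assoc]

theorem not_isTangencyWitness_of_derivation {n p m k : ℕ} {K : Type} [Field K] [Algebra ℂ K]
    {f : Fin p → MvPolynomial (Fin n) ℂ} {P : Fin p ⊕ Fin m → Fin n → MvPolynomial (Fin n) ℂ}
    {a : Fin m × Fin n → K}
    (hder : ∀ b : Fin m × Fin n → K, ∃ D : Derivation ℂ K K, ∀ q, D (a q) = b q)
    {x : Fin n → K} {c : Fin k → Fin p ⊕ Fin m → K}
    {ν : Fin k → Fin m → K} {v : Fin p → K} {w u : Fin k → Fin n → K} :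
    ¬ IsTangencyWitness f P a x c ν v w u := by
  classical
  intro H
  have hw : ∀ e l₀, w e l₀ = 0 := by
    intro e l₀
    obtain ⟨D, hD⟩ := hder fun q => if q.2 = l₀ then ν e q.1 else 0
    have hpt : ∀ i, ∑ j, aeval x (pderiv j (f i)) * D (x j) = 0 := fun i => by
      rw [← D.map_aeval_eq_sum_pderiv, H.point, map_zero]
    have hT : ∀ r l, D (pencil P x a r l) = ∑ j, aeval x (pderiv j (P r l)) * D (x j) +
        Sum.elim (fun _ => 0) (fun s => if l = l₀ then ν e s else 0) r := by
      intro r l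
      simp only [pencil, Matrix.of_apply, map_add, D.map_aeval_eq_sum_pderiv]
      rcases r with r | s <;> simp [hD]
    have hrow : ∀ d l, ∑ r, (c d r * ∑ j, aeval x (pderiv j (P r l)) * D (x j)) +
        (if l = l₀ then if d = e then 1 else 0 else 0) + ∑ r, pencil P x a r l * D (c d r) = 0 := by
      intro d l
      have h := congrArg D (H.left_null d l)
      rw [map_zero, map_sum] at h
      simp only [Derivation.leibniz, smul_eq_mul, hT, mul_add, Finset.sum_add_distrib] at h
      have hc : ∑ r, c d r * Sum.elim (fun _ => (0 : K)) (fun s => if l = l₀ then ν e s else 0) r =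
          if l = l₀ then if d = e then 1 else 0 else 0 := by
        rw [Fintype.sum_sum_type]
        by_cases hl : l = l₀ <;> simp [hl, H.dual]
      rw [hc] at h
      exact h
    have hsum : ∑ d, ∑ l, w d l * (∑ r, (c d r * ∑ j, aeval x (pderiv j (P r l)) * D (x j)) +
        (if l = l₀ then if d = e then 1 else 0 else 0) + ∑ r, pencil P x a r l * D (c d r)) = 0 :=
      Finset.sum_eq_zero fun d _ => Finset.sum_eq_zero fun l _ => by rw [hrow, mul_zero]
    simp only [mul_add, Finset.sum_add_distrib] at hsum
    have h1 : ∑ d, ∑ l, w d l * ∑ r, pencil P x a r l * D (c d r) = 0 := by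
      refine Finset.sum_eq_zero fun d _ => ?_
      simp only [Finset.mul_sum]
      rw [Finset.sum_comm]
      refine Finset.sum_eq_zero fun r _ => ?_
      calc _ = (∑ l, pencil P x a r l * w d l) * D (c d r) := by
            rw [Finset.sum_mul]
            exact Finset.sum_congr rfl fun _ _ => by ring
        _ = 0 := by rw [H.right_null, zero_mul]
    have h2 : ∑ d, ∑ l, w d l * (if l = l₀ then if d = e then (1 : K) else 0 else 0) = w e l₀ := by
      simp
    have h3 : ∑ d, ∑ l, w d l * ∑ r, (c d r * ∑ j, aeval x (pderiv j (P r l)) * D (x j)) =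
        ∑ j, (∑ i, v i * aeval x (pderiv j (f i)) +
          ∑ d, ∑ r, ∑ l, c d r * aeval x (pderiv j (P r l)) * w d l) * D (x j) := by
      have hv : ∑ j, (∑ i, v i * aeval x (pderiv j (f i))) * D (x j) = 0 := by
        simp only [Finset.sum_mul]
        rw [Finset.sum_comm]
        refine Finset.sum_eq_zero fun i _ => ?_
        simp only [mul_assoc, ← Finset.mul_sum, hpt, mul_zero]
      simp only [add_mul, Finset.sum_add_distrib, hv, zero_add]
      simp only [Finset.sum_mul, Finset.mul_sum]
      rw [Finset.sum_comm (s := Finset.univ (α := Fin n)) (t := Finset.univ (α := Fin k))]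
      refine Finset.sum_congr rfl fun d _ => ?_
      rw [Finset.sum_comm]
      rw [Finset.sum_comm (s := Finset.univ (α := Fin n))
        (t := Finset.univ (α := Fin p ⊕ Fin m))]
      refine Finset.sum_congr rfl fun r _ => ?_
      rw [Finset.sum_comm]
      exact Finset.sum_congr rfl fun j _ => Finset.sum_congr rfl fun l _ => by ring
    rw [h1, h2, h3] at hsum
    simp only [H.conormal, zero_mul, Finset.sum_const_zero, zero_add, add_zero] at hsum
    exact hsum
  simpa [hw] using H.nonzero

/-- The expressions whose vanishing defines `IsTangencyWitness`. -/
noncomputable def tangencyEquation {n p m k : ℕ} {A : Type} [CommRing A] [Algebra ℂ A]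
    (f : Fin p → MvPolynomial (Fin n) ℂ) (P : Fin p ⊕ Fin m → Fin n → MvPolynomial (Fin n) ℂ)
    (a : Fin m × Fin n → A) (x : Fin n → A) (c : Fin k → Fin p ⊕ Fin m → A)
    (ν : Fin k → Fin m → A) (v : Fin p → A) (w u : Fin k → Fin n → A) :
    Fin p ⊕ (Fin k × Fin n) ⊕ (Fin k × Fin k) ⊕ (Fin k × (Fin p ⊕ Fin m)) ⊕ Fin n ⊕ Unit → A :=
  Sum.elim (fun j => aeval x (f j)) <|
  Sum.elim (fun q => ∑ r, c q.1 r * pencil P x a r q.2) <|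
  Sum.elim (fun q => ∑ s, c q.1 (Sum.inr s) * ν q.2 s - if q.1 = q.2 then 1 else 0) <|
  Sum.elim (fun q => ∑ l, pencil P x a q.2 l * w q.1 l) <|
  Sum.elim (fun j => ∑ i, v i * aeval x (pderiv j (f i)) +
    ∑ d, ∑ r, ∑ l, c d r * aeval x (pderiv j (P r l)) * w d l)
  (fun _ => ∑ d, ∑ l, u d l * w d l - 1)

theorem isTangencyWitness_iff {n p m k : ℕ} {A : Type} [CommRing A] [Algebra ℂ A]
    {f : Fin p → MvPolynomial (Fin n) ℂ} {P : Fin p ⊕ Fin m → Fin n → MvPolynomial (Fin n) ℂ}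
    {a : Fin m × Fin n → A} {x : Fin n → A} {c : Fin k → Fin p ⊕ Fin m → A}
    {ν : Fin k → Fin m → A} {v : Fin p → A} {w u : Fin k → Fin n → A} :
    IsTangencyWitness f P a x c ν v w u ↔ ∀ e, tangencyEquation f P a x c ν v w u e = 0 := by
  constructor
  · rintro ⟨h1, h2, h3, h4, h5, h6⟩ (e | e | e | e | e | e)
    exacts [h1 e, h2 e.1 e.2, sub_eq_zero.2 (h3 e.1 e.2), h4 e.1 e.2, h5 e, sub_eq_zero.2 h6]
  · intro h
    exact ⟨fun j => h (.inl j), fun d l => h (.inr (.inl (d, l))),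
      fun d e => sub_eq_zero.1 (h (.inr (.inr (.inl (d, e))))),
      fun d r => h (.inr (.inr (.inr (.inl (d, r))))),
      fun j => h (.inr (.inr (.inr (.inr (.inl j))))),
      sub_eq_zero.1 (h (.inr (.inr (.inr (.inr (.inr ()))))))⟩

theorem map_tangencyEquation {n p m k : ℕ} {A B : Type} [CommRing A] [Algebra ℂ A] [CommRing B]
    [Algebra ℂ B] (φ : A →ₐ[ℂ] B)
    {f : Fin p → MvPolynomial (Fin n) ℂ} {P : Fin p ⊕ Fin m → Fin n → MvPolynomial (Fin n) ℂ}
    {a : Fin m × Fin n → A} {x : Fin n → A} {c : Fin k → Fin p ⊕ Fin m → A}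
    {ν : Fin k → Fin m → A} {v : Fin p → A} {w u : Fin k → Fin n → A} (e) :
    φ (tangencyEquation f P a x c ν v w u e) =
      tangencyEquation f P (fun q => φ (a q)) (fun j => φ (x j)) (fun d r => φ (c d r))
        (fun d s => φ (ν d s)) (fun j => φ (v j)) (fun d l => φ (w d l)) (fun d l => φ (u d l))
        e := by
  have hcomp : ∀ g, φ (aeval x g) = aeval (fun j => φ (x j)) g := fun g => by
    rw [comp_aeval_apply]
  have hT : ∀ r l, φ (pencil P x a r l) =
      pencil P (fun j => φ (x j)) (fun q => φ (a q)) r l := by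
    rintro (r | r) l <;> simp [pencil, hcomp]
  rcases e with e | e | e | e | e | e <;>
    simp [tangencyEquation, hcomp, hT, apply_ite φ]

theorem exists_ne_zero_forall_not_isTangencyWitness {n p m : ℕ} (k : ℕ)
    (f : Fin p → MvPolynomial (Fin n) ℂ) (P : Fin p ⊕ Fin m → Fin n → MvPolynomial (Fin n) ℂ) :
    ∃ d : MvPolynomial (Fin m × Fin n) ℂ, d ≠ 0 ∧ ∀ a : Fin m × Fin n → ℂ, eval a d ≠ 0 →
      ∀ (x : Fin n → ℂ) (c : Fin k → Fin p ⊕ Fin m → ℂ) (ν : Fin k → Fin m → ℂ) (v : Fin p → ℂ)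
        (w u : Fin k → Fin n → ℂ), ¬ IsTangencyWitness f P a x c ν v w u := by
  let Y : Type := Fin n ⊕ (Fin k × (Fin p ⊕ Fin m)) ⊕ (Fin k × Fin m) ⊕ Fin p ⊕
    (Fin k × Fin n) ⊕ (Fin k × Fin n)
  let sys {A : Type} [CommRing A] [Algebra ℂ A] (z : Y ⊕ (Fin m × Fin n) → A) :=
    tangencyEquation (k := k) f P (fun q => z (.inr q)) (fun j => z (.inl (.inl j)))
      (fun d r => z (.inl (.inr (.inl (d, r)))))
      (fun d s => z (.inl (.inr (.inr (.inl (d, s))))))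
      (fun i => z (.inl (.inr (.inr (.inr (.inl i))))))
      (fun d l => z (.inl (.inr (.inr (.inr (.inr (.inl (d, l))))))))
      (fun d l => z (.inl (.inr (.inr (.inr (.inr (.inr (d, l))))))))
  have hsys : ∀ {A : Type} [CommRing A] [Algebra ℂ A] (z : Y ⊕ (Fin m × Fin n) → A) (e),
      aeval z (sys (fun t => (X t : MvPolynomial (Y ⊕ (Fin m × Fin n)) ℂ)) e) = sys z e := by
    intro A _ _ z e
    simp only [sys, map_tangencyEquation, aeval_X]
  rcases exists_ne_zero_eval_eq_zero_or_generic_point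
    (Set.range (sys (fun t => (X t : MvPolynomial (Y ⊕ (Fin m × Fin n)) ℂ)))) with
    ⟨d, hd, h⟩ | ⟨K, _, _, z, hz, hder⟩
  · refine ⟨d, hd, fun a ha x c ν v w u H => ha ?_⟩
    refine h (Sum.elim (Sum.elim x <| Sum.elim (fun q => c q.1 q.2) <|
      Sum.elim (fun q => ν q.1 q.2) <| Sum.elim v <| Sum.elim (fun q => w q.1 q.2)
      (fun q => u q.1 q.2)) a) ?_
    rintro _ ⟨e, rfl⟩
    rw [hsys]
    exact isTangencyWitness_iff.1 H e
  · have hW : IsTangencyWitness (k := k) f P (fun q => z (.inr q)) (fun j => z (.inl (.inl j)))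
        (fun d r => z (.inl (.inr (.inl (d, r)))))
        (fun d s => z (.inl (.inr (.inr (.inl (d, s))))))
        (fun i => z (.inl (.inr (.inr (.inr (.inl i))))))
        (fun d l => z (.inl (.inr (.inr (.inr (.inr (.inl (d, l))))))))
        (fun d l => z (.inl (.inr (.inr (.inr (.inr (.inr (d, l)))))))) :=
      isTangencyWitness_iff.2 fun e => (hsys z e).symm.trans (hz _ ⟨e, rfl⟩)
    exact (not_isTangencyWitness_of_derivation hder hW).elim

theorem Matrix.mulVec_surjective_of_linearIndependent_row {R C K : Type} [Fintype R] [Fintype C]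
    [Field K] {M : Matrix R C K} (h : LinearIndependent K M.row) :
    Function.Surjective M.mulVec := by
  have hr : M.mulVecLin.range = ⊤ := Submodule.eq_top_of_finrank_eq <| by
    rw [Module.finrank_fintype_fun_eq_card]
    exact h.rank_matrix
  exact LinearMap.range_eq_top.1 hr

theorem Matrix.exists_det_submatrix_ne_zero {R C K : Type} [Fintype R] [DecidableEq R] [Fintype C]
    [Field K] {M : Matrix R C K} (h : LinearIndependent K M.row) :
    ∃ e : R → C, (M.submatrix id e).det ≠ 0 := by
  obtain ⟨κ, e, he, hspan, hli⟩ := exists_linearIndependent' K M.col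
  have : Finite κ := Finite.of_injective e he
  have : Fintype κ := Fintype.ofFinite κ
  have htop : Submodule.span K (Set.range M.col) = ⊤ := by
    rw [← Matrix.range_mulVecLin]
    exact LinearMap.range_eq_top.2 (Matrix.mulVec_surjective_of_linearIndependent_row h)
  have hcard : Fintype.card κ = Fintype.card R := by
    rw [← finrank_span_eq_card hli, hspan, htop, finrank_top, Module.finrank_fintype_fun_eq_card]
  let σ := (Fintype.equivOfCardEq hcard).symm
  refine ⟨e ∘ σ, ?_⟩
  have : LinearIndependent K (M.submatrix id (e ∘ σ)).col := hli.comp σ σ.injective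
  exact ((Matrix.isUnit_iff_isUnit_det _).1
    (Matrix.linearIndependent_cols_iff_isUnit.1 this)).ne_zero

theorem Matrix.exists_left_null_of_not_linearIndependent_row {R C K : Type} [Fintype R]
    [Field K] {M : Matrix R C K} (h : ¬ LinearIndependent K M.row) :
    ∃ c : R → K, c ≠ 0 ∧ ∀ l, ∑ r, c r * M r l = 0 := by
  obtain ⟨c, hc, r, hr⟩ := Fintype.not_linearIndependent_iff.1 h
  refine ⟨c, fun h0 => hr (congrFun h0 r), fun l => ?_⟩
  simpa [Matrix.row] using congrFun hc l

theorem Matrix.eq_zero_of_linearIndependent_row {R C K : Type} [Fintype R]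
    [Field K] {M : Matrix R C K} (h : LinearIndependent K M.row) {c : R → K}
    (hc : ∀ l, ∑ r, c r * M r l = 0) : c = 0 := by
  refine funext (Fintype.linearIndependent_iff.1 h c (funext fun l => ?_))
  simpa [Matrix.row] using hc l

theorem Matrix.linearIndependent_row_of_forall_eq_zero {R C K : Type} [Fintype R]
    [Field K] {M : Matrix R C K} (h : ∀ c : R → K, (∀ l, ∑ r, c r * M r l = 0) → c = 0) :
    LinearIndependent K M.row := by
  by_contra hM
  obtain ⟨c, hc, hcM⟩ := Matrix.exists_left_null_of_not_linearIndependent_row hM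
  exact hc (h c hcM)

theorem Matrix.rank_add_finrank_ker_vecMulLinear {R C K : Type} [Fintype R] [Fintype C] [Field K]
    (M : Matrix R C K) : M.rank + Module.finrank K M.vecMulLinear.ker = Fintype.card R := by
  have hrk : M.rank = Module.finrank K M.vecMulLinear.range := by
    rw [← Matrix.rank_transpose, Matrix.rank, ← Matrix.mulVecLin_transpose]
  rw [hrk, M.vecMulLinear.finrank_range_add_finrank_ker, Module.finrank_fintype_fun_eq_card]

theorem Matrix.add_rank_le_card_iff {R C K : Type} [Fintype R] [Fintype C] [Field K]
    {M : Matrix R C K} {k : ℕ} : k + M.rank ≤ Fintype.card R ↔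
      ∃ c : Fin k → R → K, LinearIndependent K c ∧ ∀ d l, ∑ r, c d r * M r l = 0 := by
  have h := M.rank_add_finrank_ker_vecMulLinear
  constructor
  · intro hk
    obtain ⟨c, hc⟩ := exists_linearIndependent_of_le_finrank
      (show k ≤ Module.finrank K M.vecMulLinear.ker by omega)
    exact ⟨fun d => (c d).1, hc.map' _ (Submodule.ker_subtype _),
      fun d l => congrFun (c d).2 l⟩
  · rintro ⟨c, hc, hcM⟩
    let c' : Fin k → M.vecMulLinear.ker := fun d => ⟨c d, funext fun l => hcM d l⟩
    have : LinearIndependent K c' := LinearIndependent.of_comp M.vecMulLinear.ker.subtype hc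
    have hker : k ≤ Module.finrank K M.vecMulLinear.ker := by
      simpa using this.fintype_card_le_finrank
    omega

/-- The vectors orthogonal to the image of a linear map. -/
noncomputable def orthogonalToRange {V C K : Type} [Fintype C] [Field K] [AddCommGroup V]
    [Module K V] (Ψ : V →ₗ[K] (C → K)) : Submodule K (C → K) := by
  classical
  exact (LinearMap.range Ψ).dualAnnihilator.comap (dotProductEquiv K C).toLinearMap

theorem mem_orthogonalToRange {V C K : Type} [Fintype C] [Field K] [AddCommGroup V]
    [Module K V] {Ψ : V →ₗ[K] (C → K)} {t : C → K} :
    t ∈ orthogonalToRange Ψ ↔ ∀ q, ∑ j, Ψ q j * t j = 0 := by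
  simp [orthogonalToRange, Submodule.mem_dualAnnihilator, dotProduct, mul_comm]

theorem finrank_orthogonalToRange {V C K : Type} [Fintype C] [Field K] [AddCommGroup V]
    [Module K V] [FiniteDimensional K V] {Ψ : V →ₗ[K] (C → K)} (hΨ : Function.Injective Ψ) :
    Module.finrank K V + Module.finrank K (orthogonalToRange Ψ) = Fintype.card C := by
  classical
  have h := Subspace.finrank_add_finrank_dualAnnihilator_eq (LinearMap.range Ψ)
  rw [LinearMap.finrank_range_of_inj hΨ, Module.finrank_fintype_fun_eq_card] at h
  rw [← h, orthogonalToRange]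
  congr 1
  exact LinearEquiv.finrank_eq ((dotProductEquiv K C).ofSubmodule' _)

theorem exists_dual_of_left_null {n p m k : ℕ} {K : Type} [Field K]
    {M : Matrix (Fin p ⊕ Fin m) (Fin n) K}
    {c : Fin k → Fin p ⊕ Fin m → K} (hM : LinearIndependent K fun i => M (Sum.inl i))
    (hc : LinearIndependent K c) (h : ∀ d l, ∑ r, c d r * M r l = 0) :
    ∃ ν : Fin k → Fin m → K, ∀ d e, ∑ s, c d (Sum.inr s) * ν e s = if d = e then 1 else 0 := by
  have hli : LinearIndependent K (Matrix.of fun d s => c d (Sum.inr s)).row := by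
    refine Matrix.linearIndependent_row_of_forall_eq_zero fun g hg => ?_
    simp only [Matrix.of_apply] at hg
    have hb : (fun i => ∑ d, g d * c d (Sum.inl i)) = 0 := by
      refine Matrix.eq_zero_of_linearIndependent_row (M := Matrix.of fun i => M (Sum.inl i)) hM
        fun l => ?_
      have h0 : ∑ d, g d * ∑ r, c d r * M r l = 0 := by simp [h]
      simp only [Finset.mul_sum] at h0
      rw [Finset.sum_comm, Fintype.sum_sum_type] at h0
      simp only [← mul_assoc, ← Finset.sum_mul, hg, zero_mul, Finset.sum_const_zero,
        add_zero] at h0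
      exact h0
    refine Matrix.eq_zero_of_linearIndependent_row (M := Matrix.of c) hc ?_
    rintro (i | s)
    exacts [congrFun hb i, hg s]
  obtain ⟨B, hB⟩ := Matrix.mulVec_surjective_iff_exists_right_inverse.1
    (Matrix.mulVec_surjective_of_linearIndependent_row hli)
  refine ⟨fun e s => B s e, fun d e => ?_⟩
  have := congrFun (congrFun hB d) e
  rwa [Matrix.mul_apply, Matrix.one_apply] at this

/-- The linear map whose kernel consists of the coefficients and right null vectors solving the
conormal equation of `IsTangencyWitness`. -/
noncomputable def conormalMap {n p m k : ℕ} (f : Fin p → MvPolynomial (Fin n) ℂ)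
    (P : Fin p ⊕ Fin m → Fin n → MvPolynomial (Fin n) ℂ) (a : Fin m × Fin n → ℂ)
    (x : Fin n → ℂ) (c : Fin k → Fin p ⊕ Fin m → ℂ) :
    (Fin p → ℂ) × (Fin k → (pencil P x a).mulVecLin.ker) →ₗ[ℂ] (Fin n → ℂ) where
  toFun q j := ∑ i, q.1 i * aeval x (pderiv j (f i)) +
    ∑ d, ∑ r, ∑ l, c d r * aeval x (pderiv j (P r l)) * (q.2 d).1 l
  map_add' q q' := by
    ext j
    simp only [Prod.fst_add, Prod.snd_add, Pi.add_apply, Submodule.coe_add, add_mul, mul_add,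
      Finset.sum_add_distrib]
    ring
  map_smul' b q := by
    ext j
    simp only [Prod.smul_fst, Prod.smul_snd, Pi.smul_apply, Submodule.coe_smul, smul_eq_mul,
      RingHom.id_apply, mul_add, Finset.mul_sum]
    congr 1
    · exact Finset.sum_congr rfl fun _ _ => by ring
    · exact Finset.sum_congr rfl fun _ _ => Finset.sum_congr rfl fun _ _ =>
        Finset.sum_congr rfl fun _ _ => by ring

theorem conormalMap_apply {n p m k : ℕ} {f : Fin p → MvPolynomial (Fin n) ℂ}
    {P : Fin p ⊕ Fin m → Fin n → MvPolynomial (Fin n) ℂ} {a : Fin m × Fin n → ℂ}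
    {x : Fin n → ℂ} {c : Fin k → Fin p ⊕ Fin m → ℂ} (q) (j) :
    conormalMap f P a x c q j = ∑ i, q.1 i * aeval x (pderiv j (f i)) +
      ∑ d, ∑ r, ∑ l, c d r * aeval x (pderiv j (P r l)) * (q.2 d).1 l := rfl

theorem conormalMap_injective {n p m k : ℕ} {f : Fin p → MvPolynomial (Fin n) ℂ}
    {P : Fin p ⊕ Fin m → Fin n → MvPolynomial (Fin n) ℂ} {a : Fin m × Fin n → ℂ}
    {x : Fin n → ℂ} {c : Fin k → Fin p ⊕ Fin m → ℂ}
    (hP : ∀ i l, P (Sum.inl i) l = pderiv l (f i))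
    (hW : ∀ ν v w u, ¬ IsTangencyWitness f P a x c ν v w u) (hx : ∀ i, aeval x (f i) = 0)
    (hJ : LinearIndependent ℂ fun i l => aeval x (pderiv l (f i))) (hc : LinearIndependent ℂ c)
    (h : ∀ d l, ∑ r, c d r * pencil P x a r l = 0) :
    Function.Injective (conormalMap f P a x c) := by
  classical
  rw [injective_iff_map_eq_zero]
  rintro ⟨v, w⟩ hq
  have hq' : ∀ j, ∑ i, v i * aeval x (pderiv j (f i)) +
      ∑ d, ∑ r, ∑ l, c d r * aeval x (pderiv j (P r l)) * (w d).1 l = 0 := fun j => congrFun hq j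
  obtain ⟨ν, hν⟩ := exists_dual_of_left_null (M := pencil P x a) (by
    have hrow : (fun i => pencil P x a (Sum.inl i)) = fun i l => aeval x (pderiv l (f i)) := by
      ext i l
      simp [pencil, hP]
    rwa [hrow]) hc h
  have hw : w = 0 := by
    by_contra hw
    obtain ⟨d, hd⟩ := Function.ne_iff.1 hw
    obtain ⟨l, hl⟩ := Function.ne_iff.1 (fun h0 => hd (Subtype.ext h0) : (w d).1 ≠ 0)
    refine hW ν v (fun d => (w d).1)
      (fun d' l' => if d' = d then if l' = l then ((w d).1 l)⁻¹ else 0 else 0)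
      ⟨hx, h, hν, fun d r => congrFun (w d).2 r, hq', ?_⟩
    rw [Finset.sum_eq_single d (by simp +contextual) (by simp),
      Finset.sum_eq_single l (by simp +contextual) (by simp)]
    simpa using inv_mul_cancel₀ hl
  subst hw
  have hv : v = 0 := Matrix.eq_zero_of_linearIndependent_row
    (M := Matrix.of fun i l => aeval x (pderiv l (f i))) hJ fun j => by simpa using hq' j
  rw [hv, Prod.mk_zero_zero]

theorem finrank_ker_add_rank {n p m : ℕ} (M : Matrix (Fin p ⊕ Fin m) (Fin n) ℂ) :
    Module.finrank ℂ M.mulVecLin.ker + M.rank = n := by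
  have := M.mulVecLin.finrank_range_add_finrank_ker
  rw [Module.finrank_fintype_fun_eq_card, Fintype.card_fin] at this
  rw [Matrix.rank]
  omega

theorem finrank_orthogonalToRange_conormalMap {n p m k : ℕ} {f : Fin p → MvPolynomial (Fin n) ℂ}
    {P : Fin p ⊕ Fin m → Fin n → MvPolynomial (Fin n) ℂ} {a : Fin m × Fin n → ℂ}
    {x : Fin n → ℂ} {c : Fin k → Fin p ⊕ Fin m → ℂ}
    (hinj : Function.Injective (conormalMap f P a x c)) :
    p + k * Module.finrank ℂ (pencil P x a).mulVecLin.ker +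
      Module.finrank ℂ (orthogonalToRange (conormalMap f P a x c)) = n := by
  have h := finrank_orthogonalToRange hinj
  simpa [Module.finrank_prod, Module.finrank_pi_fintype] using h

/-- If tangency witnesses with two left null vectors are excluded and the expected dimension is
small, then the left null space of the pencil is at most a line. -/
theorem not_linearIndependent_left_null_pair {n p m i : ℕ} {f : Fin p → MvPolynomial (Fin n) ℂ}
    {P : Fin p ⊕ Fin m → Fin n → MvPolynomial (Fin n) ℂ} {a : Fin m × Fin n → ℂ}
    {x : Fin n → ℂ} {c : Fin 2 → Fin p ⊕ Fin m → ℂ}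
    (hm : p + m + i = n + 1) (hi : n < p + 2 * (i + 1))
    (hP : ∀ i l, P (Sum.inl i) l = pderiv l (f i))
    (hW : ∀ ν v w u, ¬ IsTangencyWitness f P a x c ν v w u) (hx : ∀ i, aeval x (f i) = 0)
    (hJ : LinearIndependent ℂ fun i l => aeval x (pderiv l (f i)))
    (h : ∀ d l, ∑ r, c d r * pencil P x a r l = 0) : ¬ LinearIndependent ℂ c := by
  intro hc
  have h1 := finrank_orthogonalToRange_conormalMap (conormalMap_injective hP hW hx hJ hc h)
  have h2 := (pencil P x a).add_rank_le_card_iff.2 ⟨c, hc, h⟩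
  have h3 := finrank_ker_add_rank (pencil P x a)
  simp only [Fintype.card_sum, Fintype.card_fin] at h2
  omega

/-- Near a point where the left null space of a polynomial matrix is a line, suitable minors provide
polynomials restricting to a left null vector field on the degeneracy locus. -/
theorem exists_cofactors {R C σ : Type} [Fintype R] [Fintype C]
    (T : Matrix R C (MvPolynomial σ ℂ)) (x : σ → ℂ) {Z : Set (σ → ℂ)}
    (hZ : ∀ y ∈ Z, ∃ c : R → ℂ, c ≠ 0 ∧ ∀ l, ∑ r, c r * eval y (T r l) = 0) (hx : x ∈ Z)
    (huniq : ∀ c : Fin 2 → R → ℂ, (∀ d l, ∑ r, c d r * eval x (T r l) = 0) →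
      ¬ LinearIndependent ℂ c) :
    ∃ q : R → MvPolynomial σ ℂ, (fun r => eval x (q r)) ≠ 0 ∧
      ∀ y ∈ Z, ∀ l, eval y (∑ r, q r * T r l) = 0 := by
  classical
  obtain ⟨c₀, hc₀, hnull⟩ := hZ x hx
  obtain ⟨s, hs⟩ := Function.ne_iff.1 hc₀
  have hzero : ∀ c : R → ℂ, (∀ l, ∑ r, c r * eval x (T r l) = 0) → c s = 0 → c = 0 := by
    intro c hc hcs
    have h := huniq ![c₀, c] fun d l => by
      fin_cases d
      exacts [hnull l, hc l]
    rw [LinearIndependent.pair_iff] at h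
    by_contra hne
    refine h fun α β hαβ => ?_
    have hα : α = 0 := by
      have := congrFun hαβ s
      simp only [Pi.add_apply, Pi.smul_apply, hcs, smul_eq_mul, mul_zero, add_zero,
        Pi.zero_apply] at this
      exact (mul_eq_zero.1 this).resolve_right hs
    exact ⟨hα, by simpa [hα, hne] using hαβ⟩
  let E : Matrix R (C ⊕ Unit) (MvPolynomial σ ℂ) :=
    Matrix.of fun r => Sum.elim (T r) fun _ => if r = s then 1 else 0
  have hE : LinearIndependent ℂ (E.map (eval x)).row := by
    refine Matrix.linearIndependent_row_of_forall_eq_zero fun c hc => ?_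
    refine hzero c (fun l => hc (Sum.inl l)) ?_
    simpa [E, apply_ite (eval x)] using hc (Sum.inr ())
  obtain ⟨e, he⟩ := Matrix.exists_det_submatrix_ne_zero hE
  obtain ⟨j₀, hj₀⟩ : ∃ j₀, e j₀ = Sum.inr () := by
    by_contra! hne
    refine he (Matrix.exists_vecMul_eq_zero_iff.1 ⟨c₀, hc₀, funext fun j => ?_⟩)
    rcases hej : e j with l | u
    · simpa [Matrix.vecMul, dotProduct, hej, E] using hnull l
    · exact (hne j hej).elim
  have hj : ∀ j, j ≠ j₀ → ∃ l, e j = Sum.inl l := by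
    intro j hjj
    rcases hej : e j with l | u
    · exact ⟨l, rfl⟩
    · exact (he (Matrix.det_zero_of_column_eq hjj fun r => by simp [hej, hj₀])).elim
  let N : Matrix R R (MvPolynomial σ ℂ) := E.submatrix id e
  refine ⟨fun r => N.adjugate j₀ r, fun h0 => he ?_, fun y hy l => ?_⟩
  · have h1 : ∑ r, eval x (N.adjugate j₀ r) * eval x (N r j₀) = eval x N.det := by
      have := congrFun (congrFun N.adjugate_mul j₀) j₀
      rw [Matrix.mul_apply, Matrix.smul_apply, Matrix.one_apply_eq, smul_eq_mul, mul_one] at this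
      simp only [← this, map_sum, map_mul]
    have h2 : (E.map (eval x)).submatrix id e = N.map (eval x) := rfl
    rw [h2, ← RingHom.mapMatrix_apply, ← RingHom.map_det, ← h1]
    exact Finset.sum_eq_zero fun r _ => by rw [congrFun h0 r, Pi.zero_apply, zero_mul]
  · obtain ⟨c, hc, hcy⟩ := hZ y hy
    have h1 : ∑ r, N.adjugate j₀ r * T r l = (N.updateCol j₀ fun r => T r l).det := by
      rw [← Matrix.cramer_apply, Matrix.cramer_eq_adjugate_mulVec]
      rfl
    rw [h1, RingHom.map_det]
    refine Matrix.exists_vecMul_eq_zero_iff.1 ⟨c, hc, funext fun j => ?_⟩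
    by_cases hjj : j = j₀
    · subst hjj
      simpa [Matrix.vecMul, dotProduct] using hcy l
    · obtain ⟨l', hl'⟩ := hj j hjj
      simpa [Matrix.vecMul, dotProduct, Matrix.updateCol_ne hjj, N, E, hl'] using hcy l'

theorem MvPolynomial.hasStrictFDerivAt_eval {σ : Type} [Fintype σ] (g : MvPolynomial σ ℂ)
    (x : σ → ℂ) : HasStrictFDerivAt (fun y : σ → ℂ => eval y g)
      (∑ j, eval x (pderiv j g) • (ContinuousLinearMap.proj j : (σ → ℂ) →L[ℂ] ℂ)) x := by
  classical
  induction g using MvPolynomial.induction_on with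
  | C c =>
    simp only [eval_C]
    exact (hasStrictFDerivAt_const c x).congr_fderiv (ContinuousLinearMap.ext fun t => by simp)
  | add g h hg hh =>
    simp only [map_add]
    exact (hg.fun_add hh).congr_fderiv
      (ContinuousLinearMap.ext fun t => by simp [add_mul, Finset.sum_add_distrib])
  | mul_X g i hg =>
    have hX : HasStrictFDerivAt (fun y : σ → ℂ => y i)
        (ContinuousLinearMap.proj i : (σ → ℂ) →L[ℂ] ℂ) x :=
      (ContinuousLinearMap.proj i : (σ → ℂ) →L[ℂ] ℂ).hasStrictFDerivAt
    simp only [map_mul, eval_X]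
    refine (hg.fun_mul hX).congr_fderiv (ContinuousLinearMap.ext fun t => ?_)
    simp [pderiv_X, Pi.single_apply, apply_ite (eval x), add_mul, Finset.sum_add_distrib,
      Finset.mul_sum, mul_assoc]

theorem MvPolynomial.map_nhds_eval {σ ι : Type} [Fintype σ] [Fintype ι] (G : ι → MvPolynomial σ ℂ)
    (x : σ → ℂ) (h : LinearIndependent ℂ fun e s => eval x (pderiv s (G e))) :
    Filter.map (fun (y : σ → ℂ) e => eval y (G e)) (nhds x) = nhds fun e => eval x (G e) := by
  have hd : HasStrictFDerivAt (fun (y : σ → ℂ) e => eval y (G e))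
      (ContinuousLinearMap.pi fun e => ∑ j, eval x (pderiv j (G e)) •
        (ContinuousLinearMap.proj j : (σ → ℂ) →L[ℂ] ℂ)) x :=
    hasStrictFDerivAt_pi'.2 fun e => (G e).hasStrictFDerivAt_eval x
  refine hd.map_nhds_eq_of_surj (LinearMap.range_eq_top.2 fun b => ?_)
  obtain ⟨t, ht⟩ := Matrix.mulVec_surjective_of_linearIndependent_row
    (M := Matrix.of fun e s => eval x (pderiv s (G e))) h b
  refine ⟨t, ?_⟩
  ext e
  simpa [Matrix.mulVec, dotProduct] using congrFun ht e

theorem MvPolynomial.pderiv_inr_rename_inl {σ τ : Type} (g : MvPolynomial σ ℂ) (t : τ) :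
    pderiv (Sum.inr t) (rename (Sum.inl : σ → σ ⊕ τ) g) = 0 := by
  classical
  refine pderiv_eq_zero_of_notMem_vars fun ht => ?_
  have := vars_rename (Sum.inl : σ → σ ⊕ τ) g ht
  simp at this

theorem mem_tangentAt {σ : Type} [Fintype σ] [DecidableEq σ] {T : Set (σ → ℂ)} {x t : σ → ℂ} :
    t ∈ tangentAt T x ↔
      ∀ g ∈ vanishingIdeal ℂ T, ∑ l, eval x (pderiv l g) * t l = 0 := by
  simp [tangentAt, Submodule.mem_iInf]

theorem tangentAt_zcl {σ : Type} [Fintype σ] [DecidableEq σ] (T : Set (σ → ℂ)) (x : σ → ℂ) :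
    tangentAt (zcl T) x = tangentAt T x := by
  have h : vanishingIdeal ℂ (zcl T) = vanishingIdeal ℂ T :=
    (zeroLocus_vanishingIdeal_galoisConnection (k := ℂ) (K := ℂ) (σ := σ)).u_l_u_eq_u T
  rw [tangentAt, h, tangentAt]

theorem mem_zcl {σ : Type} {T : Set (σ → ℂ)} {x : σ → ℂ} :
    x ∈ zcl T ↔ ∀ g : MvPolynomial σ ℂ, (∀ y ∈ T, eval y g = 0) → eval x g = 0 := by
  simp [zcl, mem_vanishingIdeal_iff, mem_zeroLocus_iff, aeval_eq_eval]

theorem pencil_eq_eval {n p m : ℕ} (P : Fin p ⊕ Fin m → Fin n → MvPolynomial (Fin n) ℂ)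
    (a : Fin m × Fin n → ℂ) (x : Fin n → ℂ) (r l) :
    pencil P x a r l = eval x (pencil P X (fun q => C (a q)) r l) := by
  rcases r with r | s <;> simp [pencil]

theorem pderiv_pencil {n p m : ℕ} (P : Fin p ⊕ Fin m → Fin n → MvPolynomial (Fin n) ℂ)
    (a : Fin m × Fin n → ℂ) (j r l) :
    pderiv j (pencil P X (fun q => C (a q)) r l) = pderiv j (P r l) := by
  rcases r with r | s <;> simp [pencil]

/-- The regular points of `{f = 0}` at which the rows of the pencil are linearly dependent. -/
def degeneracyLocus {n p m : ℕ} (f : Fin p → MvPolynomial (Fin n) ℂ)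
    (P : Fin p ⊕ Fin m → Fin n → MvPolynomial (Fin n) ℂ) (a : Fin m × Fin n → ℂ) :
    Set (Fin n → ℂ) :=
  {x | (∀ i, aeval x (f i) = 0) ∧ (LinearIndependent ℂ fun i l => aeval x (pderiv l (f i))) ∧
    ∃ c : Fin p ⊕ Fin m → ℂ, c ≠ 0 ∧ ∀ l, ∑ r, c r * pencil P x a r l = 0}

theorem mem_degeneracyLocus_of_mem_zcl {n p m : ℕ} {f : Fin p → MvPolynomial (Fin n) ℂ}
    {P : Fin p ⊕ Fin m → Fin n → MvPolynomial (Fin n) ℂ} {a : Fin m × Fin n → ℂ}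
    {x : Fin n → ℂ} (hx : x ∈ zcl (degeneracyLocus f P a))
    (hJ : LinearIndependent ℂ fun i l => aeval x (pderiv l (f i))) :
    x ∈ degeneracyLocus f P a := by
  rw [mem_zcl] at hx
  refine ⟨fun i => hx (f i) fun y hy => hy.1 i, hJ,
    Matrix.exists_left_null_of_not_linearIndependent_row fun hli => ?_⟩
  obtain ⟨e, he⟩ := Matrix.exists_det_submatrix_ne_zero hli
  have hdet : ∀ y, eval y ((pencil P X (fun q => C (a q))).submatrix id e).det =
      ((pencil P y a).submatrix id e).det := fun y => by
    rw [RingHom.map_det]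
    congr 1
    ext r j
    exact (pencil_eq_eval P a y r (e j)).symm
  refine he ((hdet x).symm.trans (hx _ fun y hy => ?_))
  obtain ⟨-, -, c, hc, hcy⟩ := hy
  rw [hdet]
  exact Matrix.exists_vecMul_eq_zero_iff.1 ⟨c, hc, funext fun j => hcy (e j)⟩

theorem eventually_linearIndependent_jacobian {n p : ℕ} {f : Fin p → MvPolynomial (Fin n) ℂ}
    {x : Fin n → ℂ} (hJ : LinearIndependent ℂ fun i l => aeval x (pderiv l (f i))) :
    ∀ᶠ y in nhds x, LinearIndependent ℂ fun i l => aeval y (pderiv l (f i)) := by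
  obtain ⟨e, he⟩ := Matrix.exists_det_submatrix_ne_zero
    (M := Matrix.of fun i l => aeval x (pderiv l (f i))) hJ
  have hc : Continuous fun y : Fin n → ℂ =>
      ((Matrix.of fun i l => aeval y (pderiv l (f i))).submatrix id e).det := by
    refine Continuous.matrix_det (continuous_matrix fun i j => ?_)
    exact (pderiv (e j) (f i)).continuous_eval
  filter_upwards [hc.continuousAt.eventually_ne he] with y hy
  refine Matrix.linearIndependent_row_of_forall_eq_zero
    (M := Matrix.of fun i l => aeval y (pderiv l (f i))) fun c hcy => ?_
  by_contra hne
  exact hy (Matrix.exists_vecMul_eq_zero_iff.1 ⟨c, hne, funext fun j => hcy (e j)⟩)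

theorem tangentAt_degeneracyLocus_le {n p m : ℕ} {f : Fin p → MvPolynomial (Fin n) ℂ}
    {P : Fin p ⊕ Fin m → Fin n → MvPolynomial (Fin n) ℂ} {a : Fin m × Fin n → ℂ}
    {x : Fin n → ℂ} {q : Fin p ⊕ Fin m → MvPolynomial (Fin n) ℂ}
    (hq : ∀ y ∈ degeneracyLocus f P a, ∀ l,
      eval y (∑ r, q r * pencil P X (fun q => C (a q)) r l) = 0) :
    tangentAt (degeneracyLocus f P a) x ≤
      orthogonalToRange (conormalMap f P a x fun (_ : Fin 1) r => eval x (q r)) := by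
  intro t ht
  rw [mem_tangentAt] at ht
  rw [mem_orthogonalToRange]
  rintro ⟨v, w⟩
  have hf : ∀ i, ∑ j, aeval x (pderiv j (f i)) * t j = 0 := fun i =>
    ht (f i) fun y hy => hy.1 i
  have hw : ∀ r, ∑ l, pencil P x a r l * (w 0).1 l = 0 := fun r => congrFun (w 0).2 r
  have hl : ∀ l, ∑ j, (∑ r, eval x (q r) * eval x (pderiv j (P r l))) * t j +
      ∑ r, (∑ j, eval x (pderiv j (q r)) * t j) * pencil P x a r l = 0 := by
    intro l
    rw [← ht _ fun y hy => hq y hy l]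
    simp only [map_sum, Derivation.leibniz, smul_eq_mul, map_add, map_mul, pderiv_pencil,
      ← pencil_eq_eval, Finset.sum_add_distrib, add_mul]
    congr 1
    simp only [Finset.sum_mul]
    rw [Finset.sum_comm]
    exact Finset.sum_congr rfl fun _ _ => Finset.sum_congr rfl fun _ _ => by ring
  have hsum : ∑ l, (w 0).1 l * (∑ j, (∑ r, eval x (q r) * eval x (pderiv j (P r l))) * t j +
      ∑ r, (∑ j, eval x (pderiv j (q r)) * t j) * pencil P x a r l) = 0 :=
    Finset.sum_eq_zero fun l _ => by rw [hl, mul_zero]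
  simp only [mul_add, Finset.sum_add_distrib] at hsum
  have h1 : ∑ l, (w 0).1 l * ∑ r, (∑ j, eval x (pderiv j (q r)) * t j) * pencil P x a r l = 0 := by
    simp only [Finset.mul_sum]
    rw [Finset.sum_comm]
    refine Finset.sum_eq_zero fun r _ => ?_
    rw [← mul_zero (∑ j, eval x (pderiv j (q r)) * t j), ← hw r, Finset.mul_sum]
    exact Finset.sum_congr rfl fun _ _ => by ring
  rw [h1, add_zero] at hsum
  simp only [conormalMap_apply, Finset.univ_unique, Fin.default_eq_zero, Finset.sum_singleton,
    add_mul, Finset.sum_add_distrib]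
  have h2 : ∑ j, (∑ i, v i * aeval x (pderiv j (f i))) * t j = 0 := by
    simp only [Finset.sum_mul]
    rw [Finset.sum_comm]
    refine Finset.sum_eq_zero fun i _ => ?_
    simp only [mul_assoc, ← Finset.mul_sum, hf, mul_zero]
  rw [h2, zero_add, ← hsum]
  simp only [Finset.sum_mul, Finset.mul_sum]
  refine Eq.trans (Finset.sum_congr rfl fun j _ => ?_) Finset.sum_comm
  rw [Finset.sum_comm]
  exact Finset.sum_congr rfl fun _ _ => Finset.sum_congr rfl fun _ _ => by
    simp only [aeval_eq_eval]; ring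

/-- The polynomials in a point `x` and a vector `c` cutting out the pairs such that `g` and all `f i`
vanish at `x` and `c` is a left null vector of the pencil at `x`. -/
noncomputable def incidenceEquation {n p m : ℕ} (g : MvPolynomial (Fin n) ℂ)
    (f : Fin p → MvPolynomial (Fin n) ℂ) (P : Fin p ⊕ Fin m → Fin n → MvPolynomial (Fin n) ℂ)
    (a : Fin m × Fin n → ℂ) :
    Unit ⊕ Fin p ⊕ Fin n → MvPolynomial (Fin n ⊕ (Fin p ⊕ Fin m)) ℂ :=
  Sum.elim (fun _ => rename Sum.inl g) <| Sum.elim (fun i => rename Sum.inl (f i)) fun l =>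
    ∑ r, X (Sum.inr r) * rename Sum.inl (pencil P X (fun q => C (a q)) r l)

theorem eval_rename_inl {σ τ : Type} (y : σ ⊕ τ → ℂ) (g : MvPolynomial σ ℂ) :
    eval y (rename Sum.inl g) = eval (fun j => y (Sum.inl j)) g := by
  rw [eval_rename]
  rfl

theorem eval_incidenceEquation {n p m : ℕ} {g : MvPolynomial (Fin n) ℂ}
    {f : Fin p → MvPolynomial (Fin n) ℂ} {P : Fin p ⊕ Fin m → Fin n → MvPolynomial (Fin n) ℂ}
    {a : Fin m × Fin n → ℂ} (y : Fin n ⊕ (Fin p ⊕ Fin m) → ℂ) (e) :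
    eval y (incidenceEquation g f P a e) =
      Sum.elim (fun _ => eval (fun j => y (Sum.inl j)) g)
        (Sum.elim (fun i => eval (fun j => y (Sum.inl j)) (f i)) fun l =>
          ∑ r, y (Sum.inr r) * pencil P (fun j => y (Sum.inl j)) a r l) e := by
  rcases e with e | i | l
  · exact eval_rename_inl y g
  · exact eval_rename_inl y (f i)
  · simp only [incidenceEquation, Sum.elim_inr, map_sum, map_mul, eval_X, eval_rename_inl,
      pencil_eq_eval]

theorem eval_pderiv_inr_incidenceEquation {n p m : ℕ} {g : MvPolynomial (Fin n) ℂ}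
    {f : Fin p → MvPolynomial (Fin n) ℂ} {P : Fin p ⊕ Fin m → Fin n → MvPolynomial (Fin n) ℂ}
    {a : Fin m × Fin n → ℂ} (x : Fin n → ℂ) (c : Fin p ⊕ Fin m → ℂ) (r e) :
    eval (Sum.elim x c) (pderiv (Sum.inr r) (incidenceEquation g f P a e)) =
      Sum.elim (fun _ => 0) (Sum.elim (fun _ => 0) fun l => pencil P x a r l) e := by
  classical
  rcases e with e | i | l
  · simp [incidenceEquation, pderiv_inr_rename_inl]
  · simp [incidenceEquation, pderiv_inr_rename_inl]
  · simp only [incidenceEquation, Sum.elim_inr, map_sum, Derivation.leibniz, smul_eq_mul,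
      pderiv_inr_rename_inl, mul_zero, zero_add, map_mul, eval_rename_inl]
    rw [Finset.sum_eq_single r]
    · simp [pencil_eq_eval P a x]
    · intro b _ hb
      simp [hb.symm]
    · simp

theorem eval_pderiv_inl_incidenceEquation {n p m : ℕ} {g : MvPolynomial (Fin n) ℂ}
    {f : Fin p → MvPolynomial (Fin n) ℂ} {P : Fin p ⊕ Fin m → Fin n → MvPolynomial (Fin n) ℂ}
    {a : Fin m × Fin n → ℂ} (x : Fin n → ℂ) (c : Fin p ⊕ Fin m → ℂ) (j e) :
    eval (Sum.elim x c) (pderiv (Sum.inl j) (incidenceEquation g f P a e)) =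
      Sum.elim (fun _ => eval x (pderiv j g)) (Sum.elim (fun i => eval x (pderiv j (f i)))
        fun l => ∑ r, c r * eval x (pderiv j (P r l))) e := by
  classical
  rcases e with e | i | l
  · simp [incidenceEquation, pderiv_rename Sum.inl_injective, eval_rename_inl]
  · simp [incidenceEquation, pderiv_rename Sum.inl_injective, eval_rename_inl]
  · simp only [incidenceEquation, Sum.elim_inr, map_sum, Derivation.leibniz, smul_eq_mul,
      pderiv_rename Sum.inl_injective, pderiv_pencil, map_add, map_mul, eval_rename_inl]
    exact Finset.sum_congr rfl fun r _ => by simp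

theorem linearIndependent_pderiv_incidenceEquation {n p m : ℕ} {g : MvPolynomial (Fin n) ℂ}
    {f : Fin p → MvPolynomial (Fin n) ℂ} {P : Fin p ⊕ Fin m → Fin n → MvPolynomial (Fin n) ℂ}
    {a : Fin m × Fin n → ℂ} {x t : Fin n → ℂ} {c : Fin p ⊕ Fin m → ℂ}
    (hinj : Function.Injective (conormalMap f P a x fun (_ : Fin 1) => c))
    (ht : t ∈ orthogonalToRange (conormalMap f P a x fun (_ : Fin 1) => c))
    (hgt : ∑ j, eval x (pderiv j g) * t j ≠ 0) :
    LinearIndependent ℂ fun e s =>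
      eval (Sum.elim x c) (pderiv s (incidenceEquation g f P a e)) := by
  rw [mem_orthogonalToRange] at ht
  refine Matrix.linearIndependent_row_of_forall_eq_zero (M := Matrix.of fun e s =>
    eval (Sum.elim x c) (pderiv s (incidenceEquation g f P a e))) fun h hh => ?_
  have hr : ∀ r, ∑ l, pencil P x a r l * h (Sum.inr (Sum.inr l)) = 0 := by
    intro r
    rw [← hh (Sum.inr r)]
    simp only [Matrix.of_apply, eval_pderiv_inr_incidenceEquation]
    rw [Fintype.sum_sum_type, Fintype.sum_sum_type (α₁ := Fin p)]
    simp [mul_comm]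
  let q : (Fin p → ℂ) × (Fin 1 → (pencil P x a).mulVecLin.ker) :=
    (fun i => h (Sum.inr (Sum.inl i)), fun _ => ⟨fun l => h (Sum.inr (Sum.inr l)), funext hr⟩)
  have hj : ∀ j, h (Sum.inl ()) * eval x (pderiv j g) +
      conormalMap f P a x (fun _ => c) q j = 0 := by
    intro j
    rw [← hh (Sum.inl j), conormalMap_apply]
    simp only [Matrix.of_apply, eval_pderiv_inl_incidenceEquation]
    rw [Fintype.sum_sum_type, Fintype.sum_sum_type (α₁ := Fin p)]
    simp only [q, Finset.univ_unique, Finset.sum_singleton, Sum.elim_inl, Sum.elim_inr,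
      aeval_eq_eval]
    congr 2
    rw [Finset.sum_comm]
    refine Finset.sum_congr rfl fun l _ => ?_
    rw [Finset.mul_sum]
    exact Finset.sum_congr rfl fun r _ => mul_comm _ _
  have h0 : h (Sum.inl ()) = 0 := by
    have hsum : ∑ j, (h (Sum.inl ()) * eval x (pderiv j g) +
        conormalMap f P a x (fun _ => c) q j) * t j = 0 :=
      Finset.sum_eq_zero fun j _ => by rw [hj, zero_mul]
    simp only [add_mul, Finset.sum_add_distrib, ht, add_zero, mul_assoc, ← Finset.mul_sum] at hsum
    exact (mul_eq_zero.1 hsum).resolve_right hgt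
  have hq : q = 0 := (injective_iff_map_eq_zero _).1 hinj q <| funext fun j => by
    have := hj j
    rwa [h0, zero_mul, zero_add] at this
  funext e
  rcases e with e | i | l
  · exact h0
  · exact congrFun (congrArg Prod.fst hq) i
  · exact congrFun (congrArg Subtype.val (congrFun (congrArg Prod.snd hq) 0)) l

theorem orthogonalToRange_conormalMap_le {n p m : ℕ} {f : Fin p → MvPolynomial (Fin n) ℂ}
    {P : Fin p ⊕ Fin m → Fin n → MvPolynomial (Fin n) ℂ} {a : Fin m × Fin n → ℂ}
    {x : Fin n → ℂ} {c : Fin p ⊕ Fin m → ℂ} (hx : x ∈ degeneracyLocus f P a) (hc : c ≠ 0)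
    (hnull : ∀ l, ∑ r, c r * pencil P x a r l = 0)
    (hinj : Function.Injective (conormalMap f P a x fun (_ : Fin 1) => c)) :
    orthogonalToRange (conormalMap f P a x fun (_ : Fin 1) => c) ≤
      tangentAt (degeneracyLocus f P a) x := by
  classical
  intro t ht
  rw [mem_tangentAt]
  intro g hg
  by_contra hgt
  have hg0 : ∀ y ∈ degeneracyLocus f P a, eval y g = 0 := hg
  have hmap := map_nhds_eval (incidenceEquation g f P a) (Sum.elim x c)
    (linearIndependent_pderiv_incidenceEquation hinj ht hgt)
  obtain ⟨s, hs⟩ := Function.ne_iff.1 hc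
  have hzero : (fun e => eval (Sum.elim x c) (incidenceEquation g f P a e)) = 0 := by
    funext e
    rw [eval_incidenceEquation]
    rcases e with e | i | l
    exacts [hg0 x hx, hx.1 i, hnull l]
  have hU : ∀ᶠ y in nhds (Sum.elim x c : Fin n ⊕ (Fin p ⊕ Fin m) → ℂ), y (Sum.inr s) ≠ 0 ∧
      LinearIndependent ℂ fun i l => aeval (fun j => y (Sum.inl j)) (pderiv l (f i)) := by
    refine Filter.Eventually.and ?_ ?_
    · exact (continuous_apply (Sum.inr s)).continuousAt.eventually_ne hs
    · have hρ : Filter.Tendsto (fun (y : Fin n ⊕ (Fin p ⊕ Fin m) → ℂ) j => y (Sum.inl j))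
          (nhds (Sum.elim x c)) (nhds x) :=
        (continuous_pi fun j => continuous_apply (Sum.inl j)).tendsto (Sum.elim x c)
      exact hρ.eventually (eventually_linearIndependent_jacobian hx.2.1)
  have himg : ∀ᶠ b in nhds (0 : Unit ⊕ Fin p ⊕ Fin n → ℂ),
      ∃ y : Fin n ⊕ (Fin p ⊕ Fin m) → ℂ, (y (Sum.inr s) ≠ 0 ∧
        LinearIndependent ℂ fun i l => aeval (fun j => y (Sum.inl j)) (pderiv l (f i))) ∧
        (fun e => eval y (incidenceEquation g f P a e)) = b := by
    rw [← hzero, ← hmap, Filter.eventually_map]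
    filter_upwards [hU] with y hy
    exact ⟨y, hy, rfl⟩
  have hcurve : Filter.Tendsto
      (Pi.single (M := fun _ : Unit ⊕ Fin p ⊕ Fin n => ℂ) (Sum.inl ()))
      (nhdsWithin 0 {0}ᶜ) (nhds 0) := by
    have hcont :=
      (continuous_single (A := fun _ : Unit ⊕ Fin p ⊕ Fin n => ℂ) (Sum.inl ())).tendsto 0
    rw [Pi.single_zero] at hcont
    exact hcont.mono_left nhdsWithin_le_nhds
  obtain ⟨ε, ⟨y, ⟨hys, hyJ⟩, hy⟩, hε⟩ :=
    ((hcurve.eventually himg).and eventually_mem_nhdsWithin).exists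
  have hye := fun e => (eval_incidenceEquation y e).symm.trans (congrFun hy e)
  refine hε ?_
  have hyg : eval (fun j => y (Sum.inl j)) g = ε := by simpa using hye (Sum.inl ())
  rw [Set.mem_singleton_iff, ← hyg]
  refine hg0 _ ⟨fun i => ?_, hyJ, fun r => y (Sum.inr r), fun h0 => hys (congrFun h0 s),
    fun l => ?_⟩
  · simpa using hye (Sum.inr (Sum.inl i))
  · simpa only [Sum.elim_inr, ne_eq, reduceCtorEq, not_false_eq_true, Pi.single_eq_of_ne] using
      hye (Sum.inr (Sum.inr l))

theorem finrank_tangentAt_zcl_degeneracyLocus {n p m i : ℕ} {f : Fin p → MvPolynomial (Fin n) ℂ}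
    {P : Fin p ⊕ Fin m → Fin n → MvPolynomial (Fin n) ℂ} {a : Fin m × Fin n → ℂ}
    (hm : p + m + i = n + 1) (hi : n < p + 2 * (i + 1))
    (hP : ∀ i l, P (Sum.inl i) l = pderiv l (f i))
    (hW₁ : ∀ x (c : Fin 1 → _) ν v w u, ¬ IsTangencyWitness f P a x c ν v w u)
    (hW₂ : ∀ x (c : Fin 2 → _) ν v w u, ¬ IsTangencyWitness f P a x c ν v w u)
    {x : Fin n → ℂ} (hx : x ∈ zcl (degeneracyLocus f P a))
    (hJ : LinearIndependent ℂ fun i l => aeval x (pderiv l (f i))) :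
    Module.finrank ℂ (tangentAt (zcl (degeneracyLocus f P a)) x) = n - p - i := by
  have hxZ := mem_degeneracyLocus_of_mem_zcl hx hJ
  have hpair : ∀ c : Fin 2 → Fin p ⊕ Fin m → ℂ, (∀ d l, ∑ r, c d r * pencil P x a r l = 0) →
      ¬ LinearIndependent ℂ c := fun c hc =>
    not_linearIndependent_left_null_pair hm hi hP (hW₂ x c) hxZ.1 hJ hc
  obtain ⟨q, hq0, hq⟩ := exists_cofactors (pencil P X fun q => C (a q)) x
    (Z := degeneracyLocus f P a)
    (fun y hy => by
      obtain ⟨-, -, c, hc, hcy⟩ := hy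
      exact ⟨c, hc, fun l => by simpa only [← pencil_eq_eval] using hcy l⟩) hxZ
    (fun c hc => hpair c fun d l => by simpa only [← pencil_eq_eval] using hc d l)
  have hnull : ∀ l, ∑ r, eval x (q r) * pencil P x a r l = 0 := fun l => by
    simpa only [map_sum, map_mul, ← pencil_eq_eval] using hq x hxZ l
  have hind : LinearIndependent ℂ fun (_ : Fin 1) r => eval x (q r) :=
    LinearIndependent.of_subsingleton 0 hq0
  have hinj := conormalMap_injective hP (hW₁ x fun _ r => eval x (q r)) hxZ.1 hJ hind
    fun _ => hnull
  rw [tangentAt_zcl, le_antisymm (tangentAt_degeneracyLocus_le hq)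
    (orthogonalToRange_conormalMap_le hxZ hq0 hnull hinj)]
  have h1 := finrank_orthogonalToRange_conormalMap hinj
  have h2 := (pencil P x a).add_rank_le_card_iff.2 ⟨_, hind, fun _ => hnull⟩
  have h3 := finrank_ker_add_rank (pencil P x a)
  have h4 : ¬ 2 + (pencil P x a).rank ≤ p + m := fun h => by
    obtain ⟨c, hc, hcM⟩ := (pencil P x a).add_rank_le_card_iff.1 (h.trans_eq (by simp))
    exact hpair c hcM hc
  simp only [Fintype.card_sum, Fintype.card_fin] at h2
  omega

theorem Matrix.one_add_rank_le_card_iff {R C K : Type} [Fintype R] [Fintype C] [Field K]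
    {M : Matrix R C K} :
    1 + M.rank ≤ Fintype.card R ↔ ∃ c : R → K, c ≠ 0 ∧ ∀ l, ∑ r, c r * M r l = 0 := by
  rw [Matrix.add_rank_le_card_iff]
  constructor
  · rintro ⟨c, hc, hcM⟩
    exact ⟨c 0, hc.ne_zero 0, hcM 0⟩
  · rintro ⟨c, hc, hcM⟩
    exact ⟨fun _ => c, LinearIndependent.of_subsingleton 0 hc, fun _ => hcM⟩

theorem Matrix.rank_eq_card_iff_linearIndependent_row {R C K : Type} [Fintype R] [Fintype C]
    [Field K] {M : Matrix R C K} : M.rank = Fintype.card R ↔ LinearIndependent K M.row := by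
  refine ⟨fun h => ?_, fun h => h.rank_matrix⟩
  by_contra hM
  have := Matrix.one_add_rank_le_card_iff.2
    (Matrix.exists_left_null_of_not_linearIndependent_row hM)
  omega

/-- The Jacobian of `f` with appended rows `-a₀ X`. -/
noncomputable def polarPencil {n p m : ℕ} (f : Fin p → MvPolynomial (Fin n) ℂ) (a₀ : ℂ) :
    Fin p ⊕ Fin m → Fin n → MvPolynomial (Fin n) ℂ :=
  Sum.elim (fun k l => pderiv l (f k)) (fun _ l => -(C a₀ * X l))

theorem jacC_apply {n p : ℕ} (F : Fin p → MvPolynomial (Fin n) ℚ) (x : Fin n → ℂ) (k l) :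
    jacC F x k l = aeval x (pderiv l (map (algebraMap ℚ ℂ) (F k))) := by
  rw [pderiv_map, aeval_map_algebraMap]
  rfl

theorem rank_jacC_eq_iff {n p : ℕ} {F : Fin p → MvPolynomial (Fin n) ℚ} {x : Fin n → ℂ} :
    (jacC F x).rank = p ↔
      LinearIndependent ℂ fun i l => aeval x (pderiv l (map (algebraMap ℚ ℂ) (F i))) := by
  have h := (jacC F x).rank_eq_card_iff_linearIndependent_row
  rw [Fintype.card_fin] at h
  have hrow : (jacC F x).row = fun i l => aeval x (pderiv l (map (algebraMap ℚ ℂ) (F i))) := by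
    ext i l
    exact jacC_apply F x i l
  rw [h, hrow]

theorem setOf_rank_fromRows_le_eq_degeneracyLocus {n p m r : ℕ} (hr : p + m = r + 1)
    (F : Fin p → MvPolynomial (Fin n) ℚ) (a₀ : ℂ) (a : Matrix (Fin m) (Fin n) ℂ) :
    {x | x ∈ SregC F ∧
        (Matrix.fromRows (jacC F x) (Matrix.of fun k l => a k l - a₀ * x l)).rank ≤ r} =
      degeneracyLocus (fun k => map (algebraMap ℚ ℂ) (F k))
        (polarPencil (fun k => map (algebraMap ℚ ℂ) (F k)) a₀) (fun q => a q.1 q.2) := by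
  ext x
  have hpencil : Matrix.fromRows (jacC F x) (Matrix.of fun k l => a k l - a₀ * x l) =
      pencil (polarPencil (fun k => map (algebraMap ℚ ℂ) (F k)) a₀) x (fun q => a q.1 q.2) := by
    ext (k | s) l
    · simp [pencil, polarPencil, jacC_apply]
    · simp [pencil, polarPencil, sub_eq_neg_add]
  have hnull := Matrix.one_add_rank_le_card_iff (M :=
    pencil (polarPencil (fun k => map (algebraMap ℚ ℂ) (F k)) a₀) x (fun q => a q.1 q.2))
  rw [Fintype.card_sum, Fintype.card_fin, Fintype.card_fin, hr, add_comm 1,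
    Nat.add_le_add_iff_right] at hnull
  simp only [Set.mem_ofPred_eq, degeneracyLocus, SregC, zeroSetC, hpencil, hnull, rank_jacC_eq_iff,
    aeval_map_algebraMap, and_assoc]

theorem exists_ne_zero_forall_finrank_tangentAt {n p m i : ℕ} (hm : p + m + i = n + 1)
    (hi : n < p + 2 * (i + 1)) (f : Fin p → MvPolynomial (Fin n) ℂ) (a₀ : ℂ) :
    ∃ d : MvPolynomial (Fin m × Fin n) ℂ, d ≠ 0 ∧ ∀ a, eval a d ≠ 0 →
      ∀ x ∈ zcl (degeneracyLocus f (polarPencil f a₀) a),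
        (LinearIndependent ℂ fun i l => aeval x (pderiv l (f i))) →
        Module.finrank ℂ (tangentAt (zcl (degeneracyLocus f (polarPencil f a₀) a)) x) =
          n - p - i := by
  obtain ⟨d₁, hd₁, h₁⟩ :=
    exists_ne_zero_forall_not_isTangencyWitness (m := m) 1 f (polarPencil f a₀)
  obtain ⟨d₂, hd₂, h₂⟩ :=
    exists_ne_zero_forall_not_isTangencyWitness (m := m) 2 f (polarPencil f a₀)
  refine ⟨d₁ * d₂, mul_ne_zero hd₁ hd₂, fun a ha x hx hJ => ?_⟩
  rw [map_mul, mul_ne_zero_iff] at ha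
  exact finrank_tangentAt_zcl_degeneracyLocus hm hi (fun _ _ => rfl) (h₁ a ha.1) (h₂ a ha.2) hx hJ

theorem exists_ne_zero_forall_rank_eq {m n : ℕ} (h : m ≤ n) :
    ∃ d : MvPolynomial (Fin m × Fin n) ℂ, d ≠ 0 ∧
      ∀ a : Matrix (Fin m) (Fin n) ℂ, eval (fun q => a q.1 q.2) d ≠ 0 → a.rank = m := by
  let d : MvPolynomial (Fin m × Fin n) ℂ := (Matrix.of fun s t => X (s, Fin.castLE h t)).det
  have hd : ∀ a : Matrix (Fin m) (Fin n) ℂ,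
      eval (fun q => a q.1 q.2) d = (a.submatrix id (Fin.castLE h)).det := fun a => by
    rw [RingHom.map_det]
    congr 1
    ext s t
    simp
  refine ⟨d, fun h0 => ?_, fun a ha => ?_⟩
  · have h1 := hd (Matrix.of fun s t => if Fin.castLE h s = t then 1 else 0)
    have hone : (Matrix.of fun (s : Fin m) (t : Fin n) =>
        if Fin.castLE h s = t then (1 : ℂ) else 0).submatrix id (Fin.castLE h) = 1 := by
      ext s t
      simp [Matrix.one_apply]
    rw [hone, Matrix.det_one, h0, map_zero] at h1
    exact zero_ne_one h1
  · rw [hd] at ha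
    have hrow : LinearIndependent ℂ a.row :=
      Matrix.linearIndependent_row_of_forall_eq_zero fun c hc => by
        by_contra hne
        exact ha (Matrix.exists_vecMul_eq_zero_iff.1 ⟨c, hne, funext fun t => hc _⟩)
    simpa using hrow.rank_matrix

theorem zOpenMat_setOf_eval_ne_zero {m n : ℕ} (d : MvPolynomial (Fin m × Fin n) ℂ) :
    ZOpenMat {a | eval (fun q => a q.1 q.2) d ≠ 0} := by
  refine ⟨Ideal.span {d}, Set.ext fun a => ⟨fun ha => ⟨d, Ideal.mem_span_singleton_self d, ha⟩, ?_⟩⟩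
  rintro ⟨g, hg, hga⟩ h0
  obtain ⟨b, rfl⟩ := Ideal.mem_span_singleton.1 hg
  exact hga (by rw [map_mul, h0, zero_mul])

/-- Proposition 1 of the paper. Let `1 ≤ i ≤ n-p` with `2i+2 > n-p`.
Then there is a nonempty Zariski open set `O` of complex `(n-p) × n` matrices such that
for every `a ∈ O` the generic polar varieties `W_{K(a^{(i)})}(S)` and
`W_{K̄(ā^{(i)})}(S)` are smooth at every point of them where the Jacobian
`J(F₁, …, F_p)` has maximal rank `p`; smoothness at such a point means that the Zariski
tangent space there has dimension `n-p-i`, the pure dimension of the polar variety. -/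
theorem statement6 {n p i : ℕ} (hp1 : 1 ≤ p) (hpn : p ≤ n)
    (hi1 : 1 ≤ i) (hi2 : i ≤ n - p) (hcodim : 2 * i + 2 > n - p)
    (F : Fin p → MvPolynomial (Fin n) ℚ)
    (hreg : IsRegSeq (List.ofFn F))
    (hrad : idealOfDef F)
    (hSne : (zeroSetC F).Nonempty)
    (hSdim : IsPureDim (zeroSetC F) (n - p)) :
    ∃ O : Set (Matrix (Fin (n - p)) (Fin n) ℂ),
      O.Nonempty ∧ ZOpenMat O ∧
      ∀ a ∈ O,
        (firstRows a (by omega : n - p - i + 1 ≤ n - p)).rank = n - p - i + 1 ∧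
        ∀ Wc Wd : Set (Fin n → ℂ),
          Wc = Wclassic F (firstRows a (by omega : n - p - i + 1 ≤ n - p)) (n - i) →
          Wd = Wdual F (firstRows a (by omega : n - p - i + 1 ≤ n - p)) (n - i) →
          ((∀ x ∈ Wc, (jacC F x).rank = p →
              Module.finrank ℂ ↥(tangentAt Wc x) = n - p - i) ∧
           (∀ x ∈ Wd, (jacC F x).rank = p →
              Module.finrank ℂ ↥(tangentAt Wd x) = n - p - i)) := by
  obtain ⟨m, hm⟩ : ∃ m, m = n - p - i + 1 := ⟨_, rfl⟩
  have hle : m ≤ n - p := by omega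
  obtain ⟨d, hd, hrank⟩ := exists_ne_zero_forall_rank_eq (show m ≤ n by omega)
  have hcard : p + m + i = n + 1 := by omega
  have hdim : n < p + 2 * (i + 1) := by omega
  obtain ⟨d₀, hd₀, h₀⟩ := exists_ne_zero_forall_finrank_tangentAt hcard hdim
    (fun k => map (algebraMap ℚ ℂ) (F k)) 0
  obtain ⟨d₁, hd₁, h₁⟩ := exists_ne_zero_forall_finrank_tangentAt hcard hdim
    (fun k => map (algebraMap ℚ ℂ) (F k)) 1
  let ι : Fin m × Fin n → Fin (n - p) × Fin n := Prod.map (Fin.castLE hle) id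
  have hι : Function.Injective ι := (Fin.castLE_injective hle).prodMap Function.injective_id
  have hD : rename ι (d * (d₀ * d₁)) ≠ 0 :=
    (map_ne_zero_iff _ (rename_injective ι hι)).2 (mul_ne_zero hd (mul_ne_zero hd₀ hd₁))
  subst hm
  refine ⟨{a | eval (fun q => a q.1 q.2) (rename ι (d * (d₀ * d₁))) ≠ 0}, ?_,
    zOpenMat_setOf_eval_ne_zero _, fun a ha => ?_⟩
  · by_contra hempty
    refine hD (MvPolynomial.funext fun z => ?_)
    by_contra hz
    exact hempty ⟨Matrix.of fun s l => z (s, l), by simpa using hz⟩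
  · have ha' : eval (fun q => firstRows a hle q.1 q.2) (d * (d₀ * d₁)) ≠ 0 := by
      rwa [Set.mem_ofPred_eq, eval_rename] at ha
    rw [map_mul, map_mul, mul_ne_zero_iff, mul_ne_zero_iff] at ha'
    have hr : p + (n - p - i + 1) = n - i + 1 := by omega
    have hc := setOf_rank_fromRows_le_eq_degeneracyLocus hr F 0 (firstRows a hle)
    have hd := setOf_rank_fromRows_le_eq_degeneracyLocus hr F 1 (firstRows a hle)
    simp only [zero_mul, sub_zero] at hc
    simp only [one_mul] at hd
    refine ⟨hrank _ ha'.1, fun Wc Wd hWc hWd => ?_⟩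
    have hWc' := hWc.trans (congrArg zcl hc)
    have hWd' := hWd.trans (congrArg zcl hd)
    subst hWc' hWd'
    exact ⟨fun x hx hx' => h₀ _ ha'.2.1 x hx (rank_jacC_eq_iff.1 hx'),
      fun x hx hx' => h₁ _ ha'.2.2 x hx (rank_jacC_eq_iff.1 hx')⟩
end

section
/- For every integer n ≥ 6 there exist real coefficients c_{1,1}, …, c_{1,n}, c_{2,1}, …, c_{2,n}, c_1, c_2 and a real ((n−2)×n)-matrix a of maximal rank n−2 such that the quadratic polynomials F_1 := c_{1,1}X_1² + ⋯ + c_{1,n}X_n² − c_1 and F_2 := c_{2,1}X_1² + ⋯ + c_{2,n}X_n² − c_2 form a reduced regular sequence whose zero set S := {F_1 = 0, F_2 = 0} ⊂ ℂⁿ is a nonempty smooth variety of pure codimension 2, the classic polar variety W_{K^{n−3}(\underline a)}(S) is generic (nonempty and of pure codimension 1 in S, i.e., of pure codimension 3 in ℂⁿ), and W_{K^{n−3}(\underline a)}(S) contains a real point ξ at which it is singular while the Jacobian J(F_1, F_2)(ξ) has maximal rank 2. In particular, generic higher-dimensional polar varieties of smooth complete intersection varieties may be singular. -/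
open MvPolynomial

noncomputable section

/-- The common zero set in `ℂⁿ` of two real polynomials. -/
def zeroSet2 {n : ℕ} (F₁ F₂ : MvPolynomial (Fin n) ℝ) : Set (Fin n → ℂ) :=
  {x | MvPolynomial.aeval x F₁ = 0 ∧ MvPolynomial.aeval x F₂ = 0}

/-- The Jacobian `J(F₁, F₂)` at `x ∈ ℂⁿ`. -/
def jac2 {n : ℕ} (F₁ F₂ : MvPolynomial (Fin n) ℝ) (x : Fin n → ℂ) :
    Matrix (Fin 2) (Fin n) ℂ :=
  Matrix.of fun k l => MvPolynomial.aeval x (MvPolynomial.pderiv l (if k = 0 then F₁ else F₂))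

/-- The regular points of `S = {F₁ = 0, F₂ = 0}`. -/
def Sreg2 {n : ℕ} (F₁ F₂ : MvPolynomial (Fin n) ℝ) : Set (Fin n → ℂ) :=
  {x | x ∈ zeroSet2 F₁ F₂ ∧ (jac2 F₁ F₂ x).rank = 2}

/-- The classic polar variety `W_{K^{n-3}(a)}(S)` (here `p = 2`, `i = 1`): the Zariski
closure of the set of regular points of `S` where the determinant of the square matrix
obtained by stacking `J(F₁,F₂)` over `a` vanishes, i.e. where its rank is `≤ n - 1`. -/
def Wpolar7 {n : ℕ} (F₁ F₂ : MvPolynomial (Fin n) ℝ)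
    (a : Matrix (Fin (n - 2)) (Fin n) ℂ) : Set (Fin n → ℂ) :=
  zcl {x | x ∈ Sreg2 F₁ F₂ ∧ (Matrix.fromRows (jac2 F₁ F₂ x) a).rank ≤ n - 1}

end

/-- Krull dimension is invariant under injective integral extensions. -/
theorem ringKrullDim_eq_of_isIntegral_of_faithfulSMul (R S : Type*) [CommRing R] [CommRing S]
    [Algebra R S] [Algebra.IsIntegral R S] [FaithfulSMul R S] :
    ringKrullDim S = ringKrullDim R := by
  apply le_antisymm
  · refine Order.krullDim_le_of_strictMono (PrimeSpectrum.comap (algebraMap R S)) ?_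
    intro p q h
    exact Ideal.IsIntegral.comap_lt_comap (I := p.asIdeal) (J := q.asIdeal) h
  · refine iSup_le fun l => ?_
    obtain ⟨P, hP, hl⟩ := (Ideal.nonempty_primesOver (S := S) l.head.asIdeal).some
    obtain ⟨L, hL, -, -⟩ := Ideal.exists_ltSeries_of_hasGoingUp l P
    exact le_iSup_of_le L (by rw [hL])

/-- If `A ⧸ I` is integral and torsion-free over a domain `B`, then all minimal primes over `I`
have quotients of the same Krull dimension as `B`. -/
theorem ringKrullDim_quotient_minimalPrimes {A B : Type*} [CommRing A] [CommRing B] [IsDomain B]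
    (f : B →+* A) (I : Ideal A) (hint : ((Ideal.Quotient.mk I).comp f).IsIntegral)
    (htf : ∀ g h, g ≠ 0 → f g * h ∈ I → h ∈ I) {P : Ideal A} (hP : P ∈ I.minimalPrimes) :
    ringKrullDim (A ⧸ P) = ringKrullDim B := by
  have hcomp : (Ideal.Quotient.factor hP.1.2).comp ((Ideal.Quotient.mk I).comp f) =
      (Ideal.Quotient.mk P).comp f := by
    ext; simp
  have hint' : ((Ideal.Quotient.mk P).comp f).IsIntegral := by
    rw [← hcomp]
    exact hint.trans _ _
      (RingHom.isIntegral_of_surjective _ (Ideal.Quotient.factor_surjective hP.1.2))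
  let _ := ((Ideal.Quotient.mk P).comp f).toAlgebra
  have : Algebra.IsIntegral B (A ⧸ P) := ⟨hint'⟩
  have : FaithfulSMul B (A ⧸ P) := by
    rw [faithfulSMul_iff_algebraMap_injective, injective_iff_map_eq_zero]
    intro g hg
    by_contra hg0
    obtain ⟨y, hy, hxy⟩ :=
      Ideal.exists_mul_mem_of_mem_minimalPrimes hP (Ideal.Quotient.eq_zero_iff_mem.1 hg)
    exact hy (htf g y hg0 hxy)
  exact ringKrullDim_eq_of_isIntegral_of_faithfulSMul B (A ⧸ P)

namespace QuadricPair

open MvPolynomial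

/-- The affine circle equation in the variables `X p` and `X y`. -/
noncomputable def circle {σ : Type} (k : Type) [CommRing k] (p y : σ) : MvPolynomial σ k :=
  X p ^ 2 + X y ^ 2 - 1

/-- The product of two affine circles, cut by the coordinate hyperplanes indexed by `E`. -/
def locus {σ : Type} (p q y z : σ) (E : Finset σ) : Set (σ → ℂ) :=
  {x | x p ^ 2 + x y ^ 2 = 1 ∧ x q ^ 2 + x z ^ 2 = 1 ∧ ∀ k ∈ E, x k = 0}

/-- The ideal of `locus p q y z E`. -/
noncomputable def locusIdeal {σ : Type} (p q y z : σ) (E : Finset σ) : Ideal (MvPolynomial σ ℂ) :=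
  Ideal.span ({circle ℂ p y, circle ℂ q z} ∪ X '' (E : Set σ))

/-- The variables that parametrize `locus p q y z E` generically finitely. -/
abbrev Base {σ : Type} (y z : σ) (E : Finset σ) : Type := {k : σ // k ∉ E ∧ k ≠ y ∧ k ≠ z}

variable {σ : Type} {p q y z : σ} {E : Finset σ}

theorem locusIdeal_le : locusIdeal p q y z E ≤ vanishingIdeal ℂ (locus p q y z E) := by
  refine Ideal.span_le.2 ?_
  rintro f ((rfl | rfl) | ⟨k, hk, rfl⟩) x ⟨h₁, h₂, h₃⟩
  · simp [circle, h₁]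
  · simp [circle, h₂]
  · simpa using h₃ k hk

theorem circle_ne_zero {k : Type} [CommRing k] [Nontrivial k] : circle k p y ≠ 0 := by
  intro h
  have := congrArg (eval 0) h
  simp [circle] at this

theorem map_circle {k K : Type} [CommRing k] [CommRing K] (f : k →+* K) :
    map f (circle k p y) = circle K p y := by
  simp [circle]

theorem locusIdeal_empty :
    locusIdeal p q y z ∅ = Ideal.span {circle ℂ p y, circle ℂ q z} := by
  simp [locusIdeal]

theorem vanishingIdeal_zcl (T : Set (σ → ℂ)) : vanishingIdeal ℂ (zcl T) = vanishingIdeal ℂ T :=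
  zeroLocus_vanishingIdeal_galoisConnection.u_l_u_eq_u T

theorem isPureDim_union {T U : Set (σ → ℂ)} {d : ℕ} (hT : IsPureDim T d) (hU : IsPureDim U d) :
    IsPureDim (T ∪ U) d := by
  intro P hP
  have hmul : vanishingIdeal ℂ T * vanishingIdeal ℂ U ≤ P :=
    (Ideal.mul_le.2 fun f hf g hg x hx => by
      rcases hx with hx | hx
      · rw [map_mul, hf x hx, zero_mul]
      · rw [map_mul, hg x hx, mul_zero]).trans hP.1.2
  rcases hP.1.1.mul_le.1 hmul with h | h
  · exact hT P ⟨⟨hP.1.1, h⟩, fun Q hQ hQP =>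
      hP.2 ⟨hQ.1, (vanishingIdeal_anti_mono Set.subset_union_left).trans hQ.2⟩ hQP⟩
  · exact hU P ⟨⟨hP.1.1, h⟩, fun Q hQ hQP =>
      hP.2 ⟨hQ.1, (vanishingIdeal_anti_mono Set.subset_union_right).trans hQ.2⟩ hQP⟩

theorem degreeOf_circle {k : Type} [Field k] {l : σ} (hp : l ≠ p) (hy : l ≠ y) :
    degreeOf l (circle k p y) = 0 := by
  have hX : ∀ i : σ, l ≠ i → degreeOf l (X i ^ 2 : MvPolynomial σ k) = 0 := fun i hi =>
    degreeOf_X_pow_of_ne 2 hi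
  unfold circle
  refine Nat.le_zero.1 ((degreeOf_sub_le _ _ _).trans (max_le
    ((degreeOf_add_le _ _ _).trans (max_le (hX p hp).le (hX y hy).le)) ?_))
  rw [degreeOf_one]

variable [DecidableEq σ]

/-- The restriction of a coordinate function to the base, extended by zero. -/
noncomputable def baseX (y z : σ) (E : Finset σ) (k : σ) : MvPolynomial (Base y z E) ℂ :=
  if h : k ∉ E ∧ k ≠ y ∧ k ≠ z then X ⟨k, h⟩ else 0

/-- The embedding of the base ring into the full polynomial ring. -/
noncomputable abbrev emb (y z : σ) (E : Finset σ) :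
    MvPolynomial (Base y z E) ℂ →ₐ[ℂ] MvPolynomial σ ℂ := rename Subtype.val

/-- The square of the coordinate `y`, as a function on the base. -/
noncomputable def baseSq (y z : σ) (E : Finset σ) (p : σ) : MvPolynomial (Base y z E) ℂ :=
  1 - baseX y z E p ^ 2

/-- The point of `locus p q y z E` over the base point `b` with `y`- and `z`-coordinates
`ξ` and `η`. -/
def point (b : Base y z E → ℂ) (ξ η : ℂ) (k : σ) : ℂ :=
  if k = y then ξ else if k = z then η else if h : k ∉ E ∧ k ≠ y ∧ k ≠ z then b ⟨k, h⟩ else 0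

theorem eval_baseX (b : Base y z E → ℂ) (ξ η : ℂ) {k : σ} (hy : k ≠ y) (hz : k ≠ z) :
    eval b (baseX y z E k) = point b ξ η k := by
  unfold baseX point
  split_ifs <;> simp

theorem baseSq_ne_zero (p : σ) : baseSq y z E p ≠ 0 := by
  intro h
  have := congrArg (eval 0) h
  unfold baseSq baseX at this
  split_ifs at this <;> simp at this

theorem point_mem (hpy : p ≠ y) (hpz : p ≠ z) (hqy : q ≠ y) (hqz : q ≠ z) (hyz : y ≠ z)
    (hyE : y ∉ E) (hzE : z ∉ E) (b : Base y z E → ℂ) {ξ η : ℂ}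
    (hξ : ξ ^ 2 = eval b (baseSq y z E p)) (hη : η ^ 2 = eval b (baseSq y z E q)) :
    point b ξ η ∈ locus p q y z E := by
  simp only [baseSq, map_sub, map_one, map_pow, eval_baseX b ξ η hpy hpz,
    eval_baseX b ξ η hqy hqz] at hξ hη
  have h₁ : point b ξ η y = ξ := by simp [point]
  have h₂ : point b ξ η z = η := by simp [point, hyz.symm]
  refine ⟨by rw [h₁, hξ]; ring, by rw [h₂, hη]; ring, fun k hk => ?_⟩
  have hky : k ≠ y := fun h => hyE (h ▸ hk)
  have hkz : k ≠ z := fun h => hzE (h ▸ hk)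
  simp [point, hky, hkz, hk]

theorem aeval_emb_point (b : Base y z E → ℂ) (ξ η : ℂ) (f : MvPolynomial (Base y z E) ℂ) :
    aeval (point b ξ η) (emb y z E f) = eval b f := by
  have h : point b ξ η ∘ Subtype.val = b := by
    ext ⟨k, h₁, h₂, h₃⟩
    simp [point, h₁, h₂, h₃]
  rw [emb, aeval_rename, h, aeval_eq_eval]

/-- Elements of the free module over the base ring with basis `1, y, z, yz`. -/
noncomputable def normalForm (y z : σ) (E : Finset σ) (a b c d : MvPolynomial (Base y z E) ℂ) :
    MvPolynomial σ ℂ :=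
  emb y z E a + emb y z E b * X y + emb y z E c * X z + emb y z E d * (X y * X z)

theorem eq_zero_of_normalForm_mem (hpy : p ≠ y) (hpz : p ≠ z) (hqy : q ≠ y) (hqz : q ≠ z)
    (hyz : y ≠ z) (hyE : y ∉ E) (hzE : z ∉ E) {a b c d : MvPolynomial (Base y z E) ℂ}
    (h : normalForm y z E a b c d ∈ vanishingIdeal ℂ (locus p q y z E)) :
    a = 0 ∧ b = 0 ∧ c = 0 ∧ d = 0 := by
  have key : ∀ t : Base y z E → ℂ, ∀ ξ η : ℂ, ξ ^ 2 = eval t (baseSq y z E p) →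
      η ^ 2 = eval t (baseSq y z E q) →
      eval t a + eval t b * ξ + eval t c * η + eval t d * (ξ * η) = 0 := by
    intro t ξ η hξ hη
    have := h _ (point_mem hpy hpz hqy hqz hyz hyE hzE t hξ hη)
    simp only [normalForm, map_add, map_mul, aeval_emb_point, aeval_X] at this
    simpa [point, hyz.symm] using this
  have key' : ∀ t : Base y z E → ℂ, eval t a = 0 ∧ eval t (b * baseSq y z E p) = 0 ∧
      eval t (c * baseSq y z E q) = 0 ∧
      eval t (d * (baseSq y z E p * baseSq y z E q)) = 0 := by
    intro t
    obtain ⟨ξ, hξ⟩ := IsAlgClosed.exists_pow_nat_eq (eval t (baseSq y z E p)) two_pos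
    obtain ⟨η, hη⟩ := IsAlgClosed.exists_pow_nat_eq (eval t (baseSq y z E q)) two_pos
    have h₁ := key t ξ η hξ hη
    have h₂ := key t (-ξ) η (by rw [neg_sq, hξ]) hη
    have h₃ := key t ξ (-η) hξ (by rw [neg_sq, hη])
    have h₄ := key t (-ξ) (-η) (by rw [neg_sq, hξ]) (by rw [neg_sq, hη])
    simp only [map_mul, ← hξ, ← hη]
    refine ⟨?_, ?_, ?_, ?_⟩
    · linear_combination (h₁ + h₂ + h₃ + h₄) / 4
    · linear_combination ξ * (h₁ - h₂ + h₃ - h₄) / 4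
    · linear_combination η * (h₁ + h₂ - h₃ - h₄) / 4
    · linear_combination ξ * η * (h₁ - h₂ - h₃ + h₄) / 4
  have hr := baseSq_ne_zero (y := y) (z := z) (E := E) p
  have hs := baseSq_ne_zero (y := y) (z := z) (E := E) q
  refine ⟨?_, ?_, ?_, ?_⟩
  · exact MvPolynomial.funext fun t => by simpa using (key' t).1
  · exact (mul_eq_zero.1 (MvPolynomial.funext fun t => by
      rw [(key' t).2.1, map_zero] : b * baseSq y z E p = 0)).resolve_right hr
  · exact (mul_eq_zero.1 (MvPolynomial.funext fun t => by
      rw [(key' t).2.2.1, map_zero] : c * baseSq y z E q = 0)).resolve_right hs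
  · exact (mul_eq_zero.1 (MvPolynomial.funext fun t => by
      rw [(key' t).2.2.2, map_zero] : d * (baseSq y z E p * baseSq y z E q) = 0)).resolve_right
      (mul_ne_zero hr hs)

theorem mk_emb_baseX {k : σ} (hy : k ≠ y) (hz : k ≠ z) :
    Ideal.Quotient.mk (locusIdeal p q y z E) (emb y z E (baseX y z E k)) =
      Ideal.Quotient.mk (locusIdeal p q y z E) (X k) := by
  unfold baseX
  split_ifs with h
  · simp
  · have hk : k ∈ E := by tauto
    rw [map_zero, map_zero, eq_comm, Ideal.Quotient.eq_zero_iff_mem]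
    exact Ideal.subset_span (Or.inr ⟨k, hk, rfl⟩)

theorem mk_emb_baseSq_left (hpy : p ≠ y) (hpz : p ≠ z) :
    Ideal.Quotient.mk (locusIdeal p q y z E) (emb y z E (baseSq y z E p)) =
      Ideal.Quotient.mk (locusIdeal p q y z E) (X y) ^ 2 := by
  have h : Ideal.Quotient.mk (locusIdeal p q y z E) (circle ℂ p y) = 0 :=
    Ideal.Quotient.eq_zero_iff_mem.2 (Ideal.subset_span (by simp))
  simp only [circle, map_sub, map_add, map_pow, map_one] at h
  simp only [baseSq, map_sub, map_one, map_pow, mk_emb_baseX hpy hpz]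
  linear_combination -h

theorem mk_emb_baseSq_right (hqy : q ≠ y) (hqz : q ≠ z) :
    Ideal.Quotient.mk (locusIdeal p q y z E) (emb y z E (baseSq y z E q)) =
      Ideal.Quotient.mk (locusIdeal p q y z E) (X z) ^ 2 := by
  have h : Ideal.Quotient.mk (locusIdeal p q y z E) (circle ℂ q z) = 0 :=
    Ideal.Quotient.eq_zero_iff_mem.2 (Ideal.subset_span (by simp))
  simp only [circle, map_sub, map_add, map_pow, map_one] at h
  simp only [baseSq, map_sub, map_one, map_pow, mk_emb_baseX hqy hqz]
  linear_combination -h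

theorem exists_normalForm (hpy : p ≠ y) (hpz : p ≠ z) (hqy : q ≠ y) (hqz : q ≠ z)
    (f : MvPolynomial σ ℂ) : ∃ a b c d, f - normalForm y z E a b c d ∈ locusIdeal p q y z E := by
  simp only [← Ideal.Quotient.mk_eq_mk_iff_sub_mem, normalForm, map_add, map_mul]
  induction f using MvPolynomial.induction_on with
  | C r => exact ⟨C r, 0, 0, 0, by simp⟩
  | add f g hf hg =>
    obtain ⟨a, b, c, d, hf⟩ := hf
    obtain ⟨a', b', c', d', hg⟩ := hg
    refine ⟨a + a', b + b', c + c', d + d', ?_⟩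
    simp only [map_add]
    linear_combination hf + hg
  | mul_X f k hf =>
    obtain ⟨a, b, c, d, hf⟩ := hf
    have hr := mk_emb_baseSq_left (q := q) (E := E) hpy hpz
    have hs := mk_emb_baseSq_right (p := p) (E := E) hqy hqz
    set φ := Ideal.Quotient.mk (locusIdeal p q y z E)
    by_cases hy : k = y
    · subst hy
      refine ⟨b * baseSq k z E p, a, d * baseSq k z E p, c, ?_⟩
      simp only [map_mul, hr, hf]
      ring
    by_cases hz : k = z
    · subst hz
      refine ⟨c * baseSq y k E q, d * baseSq y k E q, a, b, ?_⟩
      simp only [map_mul, hs, hf]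
      ring
    · refine ⟨a * baseX y z E k, b * baseX y z E k, c * baseX y z E k, d * baseX y z E k, ?_⟩
      have hk : φ (emb y z E (baseX y z E k)) = φ (X k) := mk_emb_baseX hy hz
      simp only [map_mul, hk, hf]
      ring

theorem vanishingIdeal_locus (hpy : p ≠ y) (hpz : p ≠ z) (hqy : q ≠ y) (hqz : q ≠ z)
    (hyz : y ≠ z) (hyE : y ∉ E) (hzE : z ∉ E) :
    vanishingIdeal ℂ (locus p q y z E) = locusIdeal p q y z E := by
  refine le_antisymm (fun f hf => ?_) locusIdeal_le
  obtain ⟨a, b, c, d, h⟩ := exists_normalForm (E := E) hpy hpz hqy hqz f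
  have h' := Ideal.sub_mem _ hf (locusIdeal_le h)
  rw [sub_sub_cancel] at h'
  obtain ⟨rfl, rfl, rfl, rfl⟩ := eq_zero_of_normalForm_mem hpy hpz hqy hqz hyz hyE hzE h'
  simpa [normalForm] using h

theorem mem_locusIdeal_of_emb_mul_mem (hpy : p ≠ y) (hpz : p ≠ z) (hqy : q ≠ y) (hqz : q ≠ z)
    (hyz : y ≠ z) (hyE : y ∉ E) (hzE : z ∉ E) (g : MvPolynomial (Base y z E) ℂ)
    (f : MvPolynomial σ ℂ) (hg : g ≠ 0) (hgf : emb y z E g * f ∈ locusIdeal p q y z E) :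
    f ∈ locusIdeal p q y z E := by
  obtain ⟨a, b, c, d, h⟩ := exists_normalForm (E := E) hpy hpz hqy hqz f
  have h' := Ideal.sub_mem _ hgf (Ideal.mul_mem_left _ (emb y z E g) h)
  have h'' : normalForm y z E (g * a) (g * b) (g * c) (g * d) ∈ locusIdeal p q y z E := by
    convert h' using 1
    simp only [normalForm, map_mul]
    ring
  obtain ⟨ha, hb, hc, hd⟩ :=
    eq_zero_of_normalForm_mem hpy hpz hqy hqz hyz hyE hzE (locusIdeal_le h'')
  obtain rfl := (mul_eq_zero.1 ha).resolve_left hg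
  obtain rfl := (mul_eq_zero.1 hb).resolve_left hg
  obtain rfl := (mul_eq_zero.1 hc).resolve_left hg
  obtain rfl := (mul_eq_zero.1 hd).resolve_left hg
  simpa [normalForm] using h

theorem isIntegral_emb (hpy : p ≠ y) (hpz : p ≠ z) (hqy : q ≠ y) (hqz : q ≠ z) :
    ((Ideal.Quotient.mk (locusIdeal p q y z E)).comp (emb y z E).toRingHom).IsIntegral := by
  set φ := (Ideal.Quotient.mk (locusIdeal p q y z E)).comp (emb y z E).toRingHom
  let _ := φ.toAlgebra
  have hφ : ∀ g, IsIntegral (MvPolynomial (Base y z E) ℂ) (φ g) := fun g => isIntegral_algebraMap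
  have hy : IsIntegral (MvPolynomial (Base y z E) ℂ)
      (Ideal.Quotient.mk (locusIdeal p q y z E) (X y)) := by
    refine IsIntegral.of_pow two_pos ?_
    rw [← mk_emb_baseSq_left hpy hpz]
    exact hφ _
  have hz : IsIntegral (MvPolynomial (Base y z E) ℂ)
      (Ideal.Quotient.mk (locusIdeal p q y z E) (X z)) := by
    refine IsIntegral.of_pow two_pos ?_
    rw [← mk_emb_baseSq_right hqy hqz]
    exact hφ _
  intro f
  obtain ⟨f, rfl⟩ := Ideal.Quotient.mk_surjective f
  obtain ⟨a, b, c, d, h⟩ := exists_normalForm (E := E) hpy hpz hqy hqz f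
  rw [(Ideal.Quotient.mk_eq_mk_iff_sub_mem _ _).2 h]
  simp only [normalForm, map_add, map_mul]
  exact (((hφ a).add ((hφ b).mul hy)).add ((hφ c).mul hz)).add ((hφ d).mul (hy.mul hz))

theorem ringKrullDim_quotient_locusIdeal [Fintype σ] (hpy : p ≠ y) (hpz : p ≠ z) (hqy : q ≠ y)
    (hqz : q ≠ z) (hyz : y ≠ z) (hyE : y ∉ E) (hzE : z ∉ E) {P : Ideal (MvPolynomial σ ℂ)}
    (hP : P ∈ (locusIdeal p q y z E).minimalPrimes) :
    ringKrullDim (MvPolynomial σ ℂ ⧸ P) = ((Fintype.card σ - 2 - E.card : ℕ) : WithBot ℕ∞) := by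
  rw [ringKrullDim_quotient_minimalPrimes _ _ (isIntegral_emb hpy hpz hqy hqz)
    (mem_locusIdeal_of_emb_mul_mem hpy hpz hqy hqz hyz hyE hzE) hP,
    MvPolynomial.ringKrullDim_of_isNoetherianRing, ringKrullDim_eq_zero_of_field, zero_add]
  have h : Fintype.card (Base y z E) = Fintype.card σ - 2 - E.card := by
    rw [Fintype.card_subtype]
    have : Finset.univ.filter (fun k => k ∉ E ∧ k ≠ y ∧ k ≠ z) = (insert y (insert z E))ᶜ := by
      ext; simp; tauto
    rw [this, Finset.card_compl, Finset.card_insert_of_notMem (by simp [hyz, hyE]),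
      Finset.card_insert_of_notMem hzE]
    omega
  rw [Nat.card_eq_fintype_card, h]


theorem isRelPrime_circle {k : Type} [Field k] (hpq : p ≠ q) (hpz : p ≠ z) (hyq : y ≠ q)
    (hyz : y ≠ z) : IsRelPrime (circle k p y) (circle k q z) := by
  rintro d ⟨e, he⟩ ⟨f, hf⟩
  have hde : d * e ≠ 0 := he ▸ circle_ne_zero
  have hdf : d * f ≠ 0 := hf ▸ circle_ne_zero
  have hd : ∀ l, degreeOf l d = 0 := by
    intro l
    by_cases h : l = p ∨ l = y
    · have := degreeOf_mul_eq (n := l) (left_ne_zero_of_mul hdf) (right_ne_zero_of_mul hdf)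
      rw [← hf, degreeOf_circle (by grind) (by grind)] at this
      omega
    · have := degreeOf_mul_eq (n := l) (left_ne_zero_of_mul hde) (right_ne_zero_of_mul hde)
      rw [← he, degreeOf_circle (by tauto) (by tauto)] at this
      omega
  have hvars : d.vars = ∅ := by
    ext l
    simp [mem_vars_iff_degreeOf_ne_zero, hd]
  rw [vars_eq_empty_iff_eq_C.1 hvars]
  refine IsUnit.map C (isUnit_iff_ne_zero.2 fun h => left_ne_zero_of_mul hde ?_)
  rw [vars_eq_empty_iff_eq_C.1 hvars, h, C_0]

theorem isRegSeq_circle (hpq : p ≠ q) (hpy : p ≠ y) (hpz : p ≠ z) (hyq : y ≠ q) (hyz : y ≠ z)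
    (hqz : q ≠ z) : IsRegSeq [circle ℝ p y, circle ℝ q z] := by
  refine ⟨fun h => ?_, fun j hj b hb => ?_⟩
  · let x : σ → ℝ := fun k => if k = y ∨ k = z then 1 else 0
    have hle : Ideal.span {f | f ∈ [circle ℝ p y, circle ℝ q z]} ≤ RingHom.ker (eval x) := by
      refine Ideal.span_le.2 fun f hf => ?_
      rcases (by simpa using hf : f = circle ℝ p y ∨ f = circle ℝ q z) with rfl | rfl <;>
        simp [circle, x, hpy, hpz, hyq.symm, hqz]
    rw [h, top_le_iff] at hle
    have h1 : (1 : MvPolynomial σ ℝ) ∈ RingHom.ker (eval x) := hle ▸ Submodule.mem_top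
    simp at h1
  · match j, hj with
    | 0, _ => simpa [circle_ne_zero] using hb
    | 1, _ =>
      simp only [List.take_succ_cons, List.take_zero, List.mem_singleton, Set.ofPred_eq_eq_singleton,
        Ideal.mem_span_singleton] at hb ⊢
      exact (isRelPrime_circle hpq hpz hyq hyz).dvd_of_dvd_mul_left hb

theorem pderiv_circle {k : Type} [CommRing k] (p y l : σ) : pderiv l (circle k p y) =
    2 * X p * (Pi.single p 1 : σ → MvPolynomial σ k) l +
      2 * X y * (Pi.single y 1 : σ → MvPolynomial σ k) l := by
  simp [circle, pderiv_X, Pi.single_apply, eq_comm]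

theorem circle_eq_sum [Fintype σ] {k : Type} [CommRing k] : circle k p y =
    (∑ j, C ((Pi.single p 1 + Pi.single y 1 : σ → k) j) * X j ^ 2) - C 1 := by
  simp [circle, Pi.single_apply, add_mul, Finset.sum_add_distrib, apply_ite C]

theorem isPureDim_locus [Fintype σ] (hpy : p ≠ y) (hpz : p ≠ z) (hqy : q ≠ y)
    (hqz : q ≠ z) (hyz : y ≠ z) (hyE : y ∉ E) (hzE : z ∉ E) :
    IsPureDim (locus p q y z E) (Fintype.card σ - 2 - E.card) := by
  intro P hP
  rw [vanishingIdeal_locus hpy hpz hqy hqz hyz hyE hzE] at hP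
  exact ringKrullDim_quotient_locusIdeal hpy hpz hqy hqz hyz hyE hzE hP

/-- The real singular point of the polar variety. -/
def singularPoint {k : Type} [Zero k] [One k] (y z : σ) (j : σ) : k :=
  if j = y ∨ j = z then 1 else 0

theorem singularPoint_mem (hpy : p ≠ y) (hpz : p ≠ z) (hqy : q ≠ y) (hqz : q ≠ z)
    (hyE : y ∉ E) (hzE : z ∉ E) : singularPoint y z ∈ locus p q y z E := by
  refine ⟨by simp [singularPoint, hpy, hpz], by simp [singularPoint, hqy, hqz], fun k hk => ?_⟩
  have h₁ : k ≠ y := fun h => hyE (h ▸ hk)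
  have h₂ : k ≠ z := fun h => hzE (h ▸ hk)
  simp [singularPoint, h₁, h₂]

theorem eval_pderiv_singularPoint (hpy : p ≠ y) (hpz : p ≠ z) (hqy : q ≠ y) (hqz : q ≠ z)
    (hyz : y ≠ z) (hyE : y ∉ E) (hzE : z ∉ E) {k : σ} (hkE : k ∉ E) (hky : k ≠ y) (hkz : k ≠ z)
    {f : MvPolynomial σ ℂ} (hf : f ∈ vanishingIdeal ℂ (locus p q y z E)) :
    eval (singularPoint y z) (pderiv k f) = 0 := by
  rw [vanishingIdeal_locus hpy hpz hqy hqz hyz hyE hzE, locusIdeal] at hf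
  induction hf using Submodule.span_induction with
  | zero => simp
  | add f g _ _ hf hg => simp [hf, hg]
  | smul a f hf h =>
    have hf' : eval (singularPoint y z) f = 0 := by
      have := locusIdeal_le hf _
        (singularPoint_mem hpy hpz hqy hqz hyE hzE)
      rwa [aeval_eq_eval] at this
    simp [Derivation.leibniz, h, hf']
  | mem f hf =>
    rcases hf with (rfl | rfl) | ⟨l, hl, rfl⟩
    · rw [pderiv_circle, Pi.single_eq_of_ne hky]
      simp [singularPoint, hpy, hpz]
    · rw [pderiv_circle, Pi.single_eq_of_ne hkz]
      simp [singularPoint, hqy, hqz]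
    · have hlk : l ≠ k := fun h => hkE (h ▸ hl)
      simp [pderiv_X, hlk]

theorem le_finrank_tangentAt [Fintype σ] (hpq : p ≠ q) (hpy : p ≠ y) (hpz : p ≠ z) (hqy : q ≠ y)
    (hqz : q ≠ z) (hyz : y ≠ z) : Fintype.card σ - 2 ≤ Module.finrank ℂ
      (tangentAt (zcl (locus p q y z {p} ∪ locus p q y z {q})) (singularPoint y z)) := by
  set M := tangentAt (zcl (locus p q y z {p} ∪ locus p q y z {q})) (singularPoint y z)
  have hmem : ∀ k : {k : σ // k ∉ ({y, z} : Finset σ)}, (Pi.single k.1 1 : σ → ℂ) ∈ M := by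
    rintro ⟨k, hk⟩
    obtain ⟨hky, hkz⟩ : k ≠ y ∧ k ≠ z := by simpa using hk
    simp only [M, tangentAt, Submodule.mem_iInf, LinearMap.mem_ker, vanishingIdeal_zcl]
    intro f hf
    have : eval (singularPoint y z) (pderiv k f) = 0 := by
      by_cases hkp : k = p
      · exact eval_pderiv_singularPoint (E := {q}) hpy hpz hqy hqz hyz (by simp [hqy.symm])
          (by simp [hqz.symm]) (by simp [hkp, hpq]) hky hkz
          (vanishingIdeal_anti_mono Set.subset_union_right hf)
      · exact eval_pderiv_singularPoint (E := {p}) hpy hpz hqy hqz hyz (by simp [hpy.symm])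
          (by simp [hpz.symm]) (by simp [hkp]) hky hkz
          (vanishingIdeal_anti_mono Set.subset_union_left hf)
    simpa [Pi.single_apply] using this
  have hli : LinearIndependent ℂ
      (fun k : {k : σ // k ∉ ({y, z} : Finset σ)} => (⟨Pi.single k.1 1, hmem k⟩ : M)) := by
    refine LinearIndependent.of_comp M.subtype ?_
    exact (Pi.linearIndependent_single_one σ ℂ).comp _ Subtype.val_injective
  have := hli.fintype_card_le_finrank
  rwa [Fintype.card_subtype_compl, Fintype.card_coe, Finset.card_pair hyz] at this

section Polar

variable {n : ℕ} {p q y z : Fin n}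

theorem zeroSet2_circle : zeroSet2 (circle ℝ p y) (circle ℝ q z) = locus p q y z ∅ := by
  ext x
  simp [zeroSet2, locus, circle, sub_eq_zero]

theorem jac2_zero (x : Fin n → ℂ) (l : Fin n) : jac2 (circle ℝ p y) (circle ℝ q z) x 0 l =
    2 * x p * (Pi.single p 1 : Fin n → ℂ) l + 2 * x y * (Pi.single y 1 : Fin n → ℂ) l := by
  simp [jac2, pderiv_circle, Pi.single_apply, apply_ite (aeval x)]

theorem jac2_one (x : Fin n → ℂ) (l : Fin n) : jac2 (circle ℝ p y) (circle ℝ q z) x 1 l =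
    2 * x q * (Pi.single q 1 : Fin n → ℂ) l + 2 * x z * (Pi.single z 1 : Fin n → ℂ) l := by
  simp [jac2, pderiv_circle, Pi.single_apply, apply_ite (aeval x)]

theorem rank_jac2 (hpq : p ≠ q) (hpy : p ≠ y) (hpz : p ≠ z) (hyq : y ≠ q) (hyz : y ≠ z)
    (hqz : q ≠ z) {x : Fin n → ℂ} (hx : x ∈ locus p q y z ∅) :
    (jac2 (circle ℝ p y) (circle ℝ q z) x).rank = 2 := by
  have hli : LinearIndependent ℂ (jac2 (circle ℝ p y) (circle ℝ q z) x).row := by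
    rw [Fintype.linearIndependent_iff]
    intro g hg
    have h : ∀ l, g 0 * jac2 (circle ℝ p y) (circle ℝ q z) x 0 l +
        g 1 * jac2 (circle ℝ p y) (circle ℝ q z) x 1 l = 0 := fun l => by
      simpa [Fin.sum_univ_two] using congrFun hg l
    simp only [jac2_zero, jac2_one] at h
    have hp := h p
    have hy := h y
    have hq := h q
    have hz := h z
    simp [hpq, hpy, hpz, hyq, hyz, hqz, hpq.symm, hpy.symm, hpz.symm, hyq.symm,
      hyz.symm, hqz.symm, -mul_eq_zero] at hp hy hq hz
    have h₀ : g 0 = 0 := by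
      linear_combination x p / 2 * hp + x y / 2 * hy - g 0 * hx.1
    have h₁ : g 1 = 0 := by
      linear_combination x q / 2 * hq + x z / 2 * hz - g 1 * hx.2.1
    intro i
    fin_cases i
    exacts [h₀, h₁]
  simpa using hli.rank_matrix

theorem sreg2_circle (hpq : p ≠ q) (hpy : p ≠ y) (hpz : p ≠ z) (hyq : y ≠ q) (hyz : y ≠ z)
    (hqz : q ≠ z) :
    Sreg2 (circle ℝ p y) (circle ℝ q z) = zeroSet2 (circle ℝ p y) (circle ℝ q z) := by
  ext x
  refine ⟨fun h => h.1, fun h => ⟨h, rank_jac2 hpq hpy hpz hyq hyz hqz ?_⟩⟩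
  rwa [zeroSet2_circle] at h

/-- The projection forgetting the first two coordinates. -/
def tailMatrix (n : ℕ) : Matrix (Fin (n - 2)) (Fin n) ℝ :=
  Matrix.of fun k l => if l.val = k.val + 2 then 1 else 0

theorem tailMatrix_mulVec (v : Fin n → ℂ) (k : Fin (n - 2)) :
    ((tailMatrix n).map (fun t : ℝ => (t : ℂ))).mulVec v k =
      v ⟨k.val + 2, by omega⟩ := by
  have h : ∀ l : Fin n, (l.val = k.val + 2) = (l = ⟨k.val + 2, by omega⟩) := fun l => by
    rw [Fin.ext_iff]
  simp [tailMatrix, Matrix.mulVec, dotProduct, h, apply_ite (fun t : ℝ => (t : ℂ))]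

theorem rank_tailMatrix : ((tailMatrix n).map (fun t : ℝ => (t : ℂ))).rank = n - 2 := by
  have hsurj : Function.Surjective ((tailMatrix n).map (fun t : ℝ => (t : ℂ))).mulVecLin := by
    intro w
    refine ⟨fun l => if h : 2 ≤ l.val then w ⟨l.val - 2, by omega⟩ else 0, ?_⟩
    ext k
    rw [Matrix.mulVecLin_apply, tailMatrix_mulVec]
    simp
  rw [Matrix.rank, LinearMap.range_eq_top.2 hsurj]
  simp

theorem rank_le_iff_exists_mulVec_eq_zero {m : Type} [Fintype m] {N : ℕ} (hN : 0 < N)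
    (A : Matrix m (Fin N) ℂ) : A.rank ≤ N - 1 ↔ ∃ v ≠ 0, A.mulVec v = 0 := by
  have h := A.mulVecLin.finrank_range_add_finrank_ker
  rw [Module.finrank_fin_fun] at h
  have h' : A.rank = Module.finrank ℂ (LinearMap.range A.mulVecLin) := rfl
  have hpos : A.rank ≤ N - 1 ↔ 0 < Module.finrank ℂ (LinearMap.ker A.mulVecLin) := by omega
  rw [hpos, Module.finrank_pos_iff, Submodule.nontrivial_iff_ne_bot, Submodule.ne_bot_iff]
  simp [and_comm]

theorem jac2_mulVec_zero (x v : Fin n → ℂ) :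
    (jac2 (circle ℝ p y) (circle ℝ q z) x).mulVec v 0 = 2 * x p * v p + 2 * x y * v y := by
  simp [Matrix.mulVec, dotProduct, jac2_zero, add_mul, Finset.sum_add_distrib, Pi.single_apply]

theorem jac2_mulVec_one (x v : Fin n → ℂ) :
    (jac2 (circle ℝ p y) (circle ℝ q z) x).mulVec v 1 = 2 * x q * v q + 2 * x z * v z := by
  simp [Matrix.mulVec, dotProduct, jac2_one, add_mul, Finset.sum_add_distrib, Pi.single_apply]

theorem rank_fromRows_le_iff (hp : p.val = 0) (hq : q.val = 1) (hy : 2 ≤ y.val) (hz : 2 ≤ z.val)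
    (x : Fin n → ℂ) : (Matrix.fromRows (jac2 (circle ℝ p y) (circle ℝ q z) x)
      ((tailMatrix n).map (fun t : ℝ => (t : ℂ)))).rank ≤ n - 1 ↔ x p = 0 ∨ x q = 0 := by
  have hpq : p ≠ q := fun h => by simp [h, hq] at hp
  have hle : ∀ k : Fin n, k ≠ p → k ≠ q → 2 ≤ k.val := fun k h₁ h₂ => by
    rw [ne_eq, Fin.ext_iff] at h₁ h₂
    omega
  have hyp : y ≠ p := fun h => by subst h; omega
  have hyq : y ≠ q := fun h => by subst h; omega
  have hzp : z ≠ p := fun h => by subst h; omega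
  have hzq : z ≠ q := fun h => by subst h; omega
  rw [rank_le_iff_exists_mulVec_eq_zero (p.pos)]
  have hiff : ∀ v : Fin n → ℂ, (Matrix.fromRows (jac2 (circle ℝ p y) (circle ℝ q z) x)
      ((tailMatrix n).map (fun t : ℝ => (t : ℂ)))).mulVec v = 0 ↔
      x p * v p = 0 ∧ x q * v q = 0 ∧ ∀ k, k ≠ p → k ≠ q → v k = 0 := by
    intro v
    rw [Matrix.fromRows_mulVec]
    constructor
    · intro h
      have htail : ∀ k, k ≠ p → k ≠ q → v k = 0 := fun k h₁ h₂ => by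
        have h₃ := hle k h₁ h₂
        have h₄ := congrFun h (Sum.inr ⟨k.val - 2, by omega⟩)
        rw [Sum.elim_inr, tailMatrix_mulVec] at h₄
        simpa [Nat.sub_add_cancel h₃] using h₄
      have h₀ := congrFun h (Sum.inl 0)
      have h₁ := congrFun h (Sum.inl 1)
      rw [Sum.elim_inl, jac2_mulVec_zero, htail y hyp hyq] at h₀
      rw [Sum.elim_inl, jac2_mulVec_one, htail z hzp hzq] at h₁
      exact ⟨by simpa using h₀, by simpa using h₁, htail⟩
    · rintro ⟨h₀, h₁, htail⟩
      ext (i | k)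
      · rw [Sum.elim_inl]
        match i with
        | 0 => rw [jac2_mulVec_zero, htail y hyp hyq, mul_assoc, h₀]; simp
        | 1 => rw [jac2_mulVec_one, htail z hzp hzq, mul_assoc, h₁]; simp
      · rw [Sum.elim_inr, tailMatrix_mulVec, htail]
        · rfl
        · rw [ne_eq, Fin.ext_iff]; simp [hp]
        · rw [ne_eq, Fin.ext_iff]; simp [hq]
  simp only [hiff]
  constructor
  · rintro ⟨v, hv, h₀, h₁, htail⟩
    by_contra! hx
    refine hv (funext fun k => ?_)
    by_cases hkp : k = p
    · rw [hkp]; exact (mul_eq_zero.1 h₀).resolve_left hx.1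
    by_cases hkq : k = q
    · rw [hkq]; exact (mul_eq_zero.1 h₁).resolve_left hx.2
    · exact htail k hkp hkq
  · rintro (h | h)
    · exact ⟨Pi.single p 1, by simp, by simp [h], by simp [hpq.symm],
        fun k hk _ => by simp [hk]⟩
    · exact ⟨Pi.single q 1, by simp, by simp [hpq], by simp [h],
        fun k _ hk => by simp [hk]⟩

theorem wpolar7_circle (hp : p.val = 0) (hq : q.val = 1) (hy : 2 ≤ y.val) (hz : 2 ≤ z.val)
    (hyz : y ≠ z) : Wpolar7 (circle ℝ p y) (circle ℝ q z)
      ((tailMatrix n).map (fun t : ℝ => (t : ℂ))) =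
      zcl (locus p q y z {p} ∪ locus p q y z {q}) := by
  have hpq : p ≠ q := fun h => by simp [h, hq] at hp
  have hpy : p ≠ y := fun h => by subst h; omega
  have hyq : y ≠ q := fun h => by subst h; omega
  have hpz : p ≠ z := fun h => by subst h; omega
  have hqz : q ≠ z := fun h => by subst h; omega
  unfold Wpolar7
  congr 1
  ext x
  simp only [Set.mem_ofPred_eq, rank_fromRows_le_iff hp hq hy hz,
    sreg2_circle hpq hpy hpz hyq hyz hqz, zeroSet2_circle]
  simp [locus]
  tauto

end Polar

end QuadricPair

open QuadricPair

/-- Section 3.1 of the paper. For every `n ≥ 6` there are real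
coefficients `c₁, c₂ : Fin n → ℝ`, `d₁ d₂ : ℝ` and a real `(n-2) × n` matrix `a` of
maximal rank such that `F₁ = ∑ c₁ⱼ Xⱼ² − d₁`, `F₂ = ∑ c₂ⱼ Xⱼ² − d₂` form a reduced
regular sequence whose zero set `S ⊆ ℂⁿ` is a nonempty smooth variety of pure
codimension `2`, the classic polar variety `W_{K^{n-3}(a)}(S)` is generic (nonempty and
of pure codimension `3` in `ℂⁿ`, i.e. of pure dimension `n-3`), and it contains a real
point `ξ` at which it is singular (its Zariski tangent space there does not have the
dimension `n-3`) while the Jacobian `J(F₁,F₂)(ξ)` has maximal rank `2`. -/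
theorem statement7 (n : ℕ) (hn : 6 ≤ n) :
    ∃ c₁ c₂ : Fin n → ℝ, ∃ d₁ d₂ : ℝ,
    ∃ a : Matrix (Fin (n - 2)) (Fin n) ℝ,
    ∃ F₁ F₂ : MvPolynomial (Fin n) ℝ,
      F₁ = (∑ j, MvPolynomial.C (c₁ j) * MvPolynomial.X j ^ 2) - MvPolynomial.C d₁ ∧
      F₂ = (∑ j, MvPolynomial.C (c₂ j) * MvPolynomial.X j ^ 2) - MvPolynomial.C d₂ ∧
      (a.map (fun t : ℝ => (t : ℂ))).rank = n - 2 ∧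
      IsRegSeq [F₁, F₂] ∧
      MvPolynomial.vanishingIdeal ℂ (zeroSet2 F₁ F₂) =
        Ideal.span {MvPolynomial.map (algebraMap ℝ ℂ) F₁,
                    MvPolynomial.map (algebraMap ℝ ℂ) F₂} ∧
      (zeroSet2 F₁ F₂).Nonempty ∧
      Sreg2 F₁ F₂ = zeroSet2 F₁ F₂ ∧
      IsPureDim (zeroSet2 F₁ F₂) (n - 2) ∧
      ∀ W : Set (Fin n → ℂ), W = Wpolar7 F₁ F₂ (a.map (fun t : ℝ => (t : ℂ))) →
        W.Nonempty ∧ IsPureDim W (n - 3) ∧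
        ∃ ξ : Fin n → ℝ,
          (fun j => (ξ j : ℂ)) ∈ W ∧
          (jac2 F₁ F₂ (fun j => (ξ j : ℂ))).rank = 2 ∧
          Module.finrank ℂ ↥(tangentAt W (fun j => (ξ j : ℂ))) ≠ n - 3 := by
  let p : Fin n := ⟨0, by omega⟩
  let q : Fin n := ⟨1, by omega⟩
  let y : Fin n := ⟨2, by omega⟩
  let z : Fin n := ⟨3, by omega⟩
  have hpq : p ≠ q := by simp [p, q]
  have hpy : p ≠ y := by simp [p, y]
  have hpz : p ≠ z := by simp [p, z]
  have hqy : q ≠ y := by simp [q, y]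
  have hqz : q ≠ z := by simp [q, z]
  have hyz : y ≠ z := by simp [y, z]
  have hreal : (fun j => ((singularPoint y z j : ℝ) : ℂ)) = singularPoint y z := by
    ext j
    simp [singularPoint, apply_ite (fun t : ℝ => (t : ℂ))]
  have hmem := singularPoint_mem (E := ∅) hpy hpz hqy hqz (by simp) (by simp)
  refine ⟨_, _, _, _, tailMatrix n, _, _, circle_eq_sum (p := p) (y := y),
    circle_eq_sum (p := q) (y := z), rank_tailMatrix,
    isRegSeq_circle hpq hpy hpz hqy.symm hyz hqz, ?_, ?_,
    sreg2_circle hpq hpy hpz hqy.symm hyz hqz, ?_, ?_⟩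
  · rw [zeroSet2_circle, vanishingIdeal_locus hpy hpz hqy hqz hyz (by simp) (by simp),
      locusIdeal_empty, map_circle, map_circle]
  · rw [zeroSet2_circle]
    exact ⟨_, hmem⟩
  · rw [zeroSet2_circle]
    simpa using isPureDim_locus (E := ∅) hpy hpz hqy hqz hyz (by simp) (by simp)
  · rintro W rfl
    rw [wpolar7_circle rfl rfl le_rfl (Nat.le_succ 2) hyz]
    have hW : singularPoint y z ∈ zcl (locus p q y z {p} ∪ locus p q y z {q}) :=
      zeroLocus_vanishingIdeal_le _ (Or.inl (singularPoint_mem hpy hpz hqy hqz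
        (by simp [hpy.symm]) (by simp [hpz.symm])))
    refine ⟨⟨_, hW⟩, ?_, singularPoint y z, by rwa [hreal], ?_, ?_⟩
    · unfold IsPureDim
      rw [vanishingIdeal_zcl]
      refine isPureDim_union ?_ ?_
      · simpa [Nat.sub_sub] using isPureDim_locus (E := {p}) hpy hpz hqy hqz hyz
          (by simp [hpy.symm]) (by simp [hpz.symm])
      · simpa [Nat.sub_sub] using isPureDim_locus (E := {q}) hpy hpz hqy hqz hyz
          (by simp [hqy.symm]) (by simp [hqz.symm])
    · rw [hreal]
      exact rank_jac2 hpq hpy hpz hqy.symm hyz hqz hmem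
    · rw [hreal]
      have := le_finrank_tangentAt hpq hpy hpz hqy hqz hyz
      rw [Fintype.card_fin] at this
      omega
end
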